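/- If G is a finite solvable group, then the number of conjugacy classes of G consisting of elements of prime power order is less than or equal to the number of Q_pp-valued irreducible characters of G. -/

import Mathlib

open scoped Classical

noncomputable section

/-- `Qfield p` is the subfield of `ℂ` obtained by adjoining to `ℚ` all `p^a`-th
roots of unity for all positive integers `a` (any subfield of `ℂ` contains `ℚ`). -/
def Qfield (p : ℕ) : Subfield ℂ :=
  Subfield.closure {x : ℂ | ∃ a : ℕ, 0 < a ∧ x ^ p ^ a = 1}

/-- `χ : G → ℂ` is an irreducible (ordinary, complex) character of `G` if it is the
character of some simple finite-dimensional complex representation of `G`. -/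
def IsIrreducibleCharacter (G : Type) [Group G] (χ : G → ℂ) : Prop :=
  ∃ V : FDRep ℂ G, CategoryTheory.Simple V ∧ χ = fun g => V.character g

/-- The set of `Q_pp`-valued irreducible characters of `G`: irreducible characters all
of whose values lie in `Qfield p` for some prime `p`. -/
def QppValuedIrrChars (G : Type) [Group G] : Set (G → ℂ) :=
  {χ | IsIrreducibleCharacter G χ ∧ ∃ p : ℕ, p.Prime ∧ ∀ g, χ g ∈ Qfield p}

/-- The set of conjugacy classes of `G` consisting of elements of prime power order
(the identity, of order `p ^ 0 = 1`, is included). -/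
def PrimePowerClasses (G : Type) [Group G] : Set (ConjClasses G) :=
  {c | ∃ g : G, c = ConjClasses.mk g ∧ ∃ p k : ℕ, p.Prime ∧ orderOf g = p ^ k}

section

set_option linter.unusedSectionVars false

open Representation

variable {Γ : Type} [Group Γ] [Fintype Γ]

/-- The bilinear scalar product of two functions along a subgroup. -/
def ip (H : Subgroup Γ) (f g : Γ → ℂ) : ℂ :=
  (Nat.card H : ℂ)⁻¹ * ∑ h : H, f h * g (h : Γ)⁻¹

/-- The restriction of `f` to `H` is an ordinary character of `H`. -/
def IsChar (H : Subgroup Γ) (f : Γ → ℂ) : Prop :=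
  ∃ (V : Type) (_ : AddCommGroup V) (_ : Module ℂ V) (_ : FiniteDimensional ℂ V)
    (ρ : Representation ℂ H V), ∀ h : H, f h = ρ.character h

/-- The restriction of `f` to `H` is an irreducible character of `H`. -/
def Irr (H : Subgroup Γ) (f : Γ → ℂ) : Prop :=
  ∃ (V : Type) (_ : AddCommGroup V) (_ : Module ℂ V) (_ : FiniteDimensional ℂ V)
    (ρ : Representation ℂ H V), ρ.IsIrreducible ∧ ∀ h : H, f h = ρ.character h

theorem Irr.isChar {H : Subgroup Γ} {f : Γ → ℂ} (h : Irr H f) : IsChar H f := by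
  obtain ⟨V, i1, i2, i3, ρ, -, h⟩ := h
  exact ⟨V, i1, i2, i3, ρ, h⟩

theorem IsChar.congr {H : Subgroup Γ} {f g : Γ → ℂ} (h : IsChar H f)
    (e : ∀ x ∈ H, g x = f x) : IsChar H g := by
  obtain ⟨V, i1, i2, i3, ρ, h⟩ := h
  exact ⟨V, i1, i2, i3, ρ, fun x => (e x x.2).trans (h x)⟩

theorem Irr.congr {H : Subgroup Γ} {f g : Γ → ℂ} (h : Irr H f)
    (e : ∀ x ∈ H, g x = f x) : Irr H g := by
  obtain ⟨V, i1, i2, i3, ρ, h0, h⟩ := h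
  exact ⟨V, i1, i2, i3, ρ, h0, fun x => (e x x.2).trans (h x)⟩

theorem ip_congr {H : Subgroup Γ} {f g f' g' : Γ → ℂ} (hf : ∀ x ∈ H, f x = f' x)
    (hg : ∀ x ∈ H, g x = g' x) : ip H f g = ip H f' g' := by
  unfold ip
  congr 1
  exact Finset.sum_congr rfl fun x _ => by rw [hf x x.2, hg _ (H.inv_mem x.2)]

theorem card_ne_zero' (H : Subgroup Γ) : (Nat.card H : ℂ) ≠ 0 :=
  Nat.cast_ne_zero.mpr Nat.card_pos.ne'

theorem ip_eq_ite (H : Subgroup Γ) (f g : Γ → ℂ) :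
    ip H f g = (Nat.card H : ℂ)⁻¹ * ∑ x : Γ, if x ∈ H then f x * g x⁻¹ else 0 := by
  unfold ip
  congr 1
  rw [← Finset.sum_filter]
  exact (Finset.sum_subtype (p := fun x => x ∈ H) _ (by simp) (fun x => f x * g x⁻¹)).symm

theorem ip_comm (H : Subgroup Γ) (f g : Γ → ℂ) : ip H f g = ip H g f := by
  unfold ip
  congr 1
  rw [← Equiv.sum_comp (Equiv.inv H)]
  exact Finset.sum_congr rfl fun x _ => by simp [mul_comm]

theorem ip_add_left (H : Subgroup Γ) (f f' g : Γ → ℂ) :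
    ip H (f + f') g = ip H f g + ip H f' g := by
  simp [ip, add_mul, Finset.sum_add_distrib, mul_add]

theorem ip_smul_left (H : Subgroup Γ) (c : ℂ) (f g : Γ → ℂ) :
    ip H (c • f) g = c * ip H f g := by
  simp only [ip, Pi.smul_apply, smul_eq_mul, Finset.mul_sum]
  exact Finset.sum_congr rfl fun x _ => by ring

theorem ip_sum_left {ι : Type*} (s : Finset ι) (H : Subgroup Γ) (f : ι → Γ → ℂ) (g : Γ → ℂ) :
    ip H (fun x => ∑ i ∈ s, f i x) g = ∑ i ∈ s, ip H (f i) g := by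
  simp only [ip, Finset.sum_mul, Finset.mul_sum]
  rw [Finset.sum_comm]

theorem ip_zero_left (H : Subgroup Γ) (g : Γ → ℂ) : ip H (fun _ => 0) g = 0 := by
  simp [ip]

theorem ip_char_eq {H : Subgroup Γ} {V W : Type} [AddCommGroup V] [Module ℂ V]
    [FiniteDimensional ℂ V] [AddCommGroup W] [Module ℂ W] [FiniteDimensional ℂ W]
    (ρ : Representation ℂ H V) (σ : Representation ℂ H W) {f g : Γ → ℂ}
    (hf : ∀ h : H, f h = ρ.character h) (hg : ∀ h : H, g h = σ.character h) :
    ip H f g = (Module.finrank ℂ (IntertwiningMap σ ρ) : ℂ) := by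
  have : Invertible (Nat.card H : ℂ) := invertibleOfNonzero (card_ne_zero' H)
  rw [← card_inv_mul_sum_char_mul_char_eq_finrank σ ρ, ip]
  congr 1
  exact Finset.sum_congr rfl fun x _ => by rw [hf, ← hg]; rfl

theorem IsChar.ip_nat {H : Subgroup Γ} {f g : Γ → ℂ} (hf : IsChar H f) (hg : IsChar H g) :
    ∃ n : ℕ, ip H f g = n := by
  obtain ⟨V, _, _, _, ρ, hf⟩ := hf
  obtain ⟨W, _, _, _, σ, hg⟩ := hg
  exact ⟨_, ip_char_eq ρ σ hf hg⟩

theorem IsChar.conj {H : Subgroup Γ} {f : Γ → ℂ} (hf : IsChar H f) {g x : Γ} (hg : g ∈ H)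
    (hx : x ∈ H) : f (g * x * g⁻¹) = f x := by
  obtain ⟨V, _, _, _, ρ, hf⟩ := hf
  have := hf (⟨g, hg⟩ * ⟨x, hx⟩ * ⟨g, hg⟩⁻¹)
  rw [char_conj] at this
  rw [hf ⟨x, hx⟩, ← this]
  rfl

theorem IsChar.one_nat {H : Subgroup Γ} {f : Γ → ℂ} (hf : IsChar H f) :
    ∃ n : ℕ, f 1 = n := by
  obtain ⟨V, _, _, _, ρ, hf⟩ := hf
  exact ⟨_, (hf 1).trans (char_one ρ)⟩

theorem IsChar.eq_zero_of_one {H : Subgroup Γ} {f : Γ → ℂ} (hf : IsChar H f) (h : f 1 = 0) :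
    ∀ x ∈ H, f x = 0 := by
  obtain ⟨V, _, _, _, ρ, hf⟩ := hf
  have h1 := (hf 1).symm.trans h
  rw [char_one, Nat.cast_eq_zero] at h1
  have := Module.finrank_zero_iff.mp h1
  intro x hx
  rw [hf ⟨x, hx⟩, Representation.character, Subsingleton.elim (ρ _) 0, map_zero]

theorem IsChar.eq_zero_of_ip {H : Subgroup Γ} {f : Γ → ℂ} (hf : IsChar H f) (h : ip H f f = 0) :
    ∀ x ∈ H, f x = 0 := by
  have hf' := hf
  obtain ⟨V, _, _, _, ρ, hf⟩ := hf
  have h1 := (ip_char_eq ρ ρ hf hf).symm.trans h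
  rw [Nat.cast_eq_zero] at h1
  have := Module.finrank_zero_iff.mp h1
  have h2 : ∀ v : V, v = 0 := fun v =>
    congrArg (fun F : IntertwiningMap ρ ρ => F v) (Subsingleton.elim (IntertwiningMap.id ρ) 0)
  have : Subsingleton V := ⟨fun a b => (h2 a).trans (h2 b).symm⟩
  refine hf'.eq_zero_of_one ?_
  have := hf 1
  rw [char_one, Module.finrank_zero_of_subsingleton] at this
  simpa using this

theorem IsChar.restrict {H K : Subgroup Γ} (hHK : H ≤ K) {f : Γ → ℂ} (hf : IsChar K f) :
    IsChar H f := by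
  obtain ⟨V, i1, i2, i3, ρ, hf⟩ := hf
  exact ⟨V, i1, i2, i3, ρ.comp (Subgroup.inclusion hHK), fun h => hf (Subgroup.inclusion hHK h)⟩

theorem IsChar.mul {H : Subgroup Γ} {f g : Γ → ℂ} (hf : IsChar H f) (hg : IsChar H g) :
    IsChar H (fun x => f x * g x) := by
  obtain ⟨V, i1, i2, i3, ρ, hf⟩ := hf
  obtain ⟨W, j1, j2, j3, σ, hg⟩ := hg
  refine ⟨TensorProduct ℂ V W, inferInstance, inferInstance, inferInstance, ρ.tprod σ, fun h => ?_⟩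
  rw [char_tensor, Pi.mul_apply, ← hf, ← hg]

theorem IsChar.add {H : Subgroup Γ} {f g : Γ → ℂ} (hf : IsChar H f) (hg : IsChar H g) :
    IsChar H (f + g) := by
  obtain ⟨V, i1, i2, i3, ρ, hf⟩ := hf
  obtain ⟨W, j1, j2, j3, σ, hg⟩ := hg
  refine ⟨V × W, inferInstance, inferInstance, inferInstance, ρ.prod σ, fun h => ?_⟩
  rw [Pi.add_apply, hf, hg]
  exact (LinearMap.trace_prodMap' (ρ h) (σ h)).symm

theorem isChar_zero (H : Subgroup Γ) : IsChar H (fun _ => 0) :=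
  ⟨Fin 0 → ℂ, inferInstance, inferInstance, inferInstance, Representation.trivial ℂ H _, fun h => by
    rw [Representation.character, Subsingleton.elim (Representation.trivial ℂ H _ h) 0, map_zero]⟩

theorem isChar_one (H : Subgroup Γ) : IsChar H fun _ => 1 :=
  ⟨ℂ, inferInstance, inferInstance, inferInstance, Representation.trivial ℂ H ℂ, fun h => by
    simp [Representation.character, Representation.trivial]⟩

theorem IsChar.sum {ι : Type*} (s : Finset ι) {H : Subgroup Γ} {f : ι → Γ → ℂ}
    (hf : ∀ i ∈ s, IsChar H (f i)) : IsChar H (fun x => ∑ i ∈ s, f i x) := by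
  induction s using Finset.induction_on with
  | empty => simpa using isChar_zero H
  | insert a s ha ih =>
    refine ((hf a (by simp)).add (ih fun i hi => hf i (by simp [hi]))).congr fun x _ => ?_
    simp [Finset.sum_insert ha]

theorem IsChar.nsmul {H : Subgroup Γ} {f : Γ → ℂ} (hf : IsChar H f) (n : ℕ) :
    IsChar H (fun x => n * f x) := by
  refine (IsChar.sum (Finset.range n) fun _ _ => hf).congr fun x _ => by simp

theorem Irr.ip_self {H : Subgroup Γ} {f : Γ → ℂ} (hf : Irr H f) : ip H f f = 1 := by
  obtain ⟨V, _, _, _, ρ, h0, hf⟩ := hf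
  rw [ip_char_eq ρ ρ hf hf, IsIrreducible.finrank_intertwiningMap_self, Nat.cast_one]

theorem Irr.one_ne_zero {H : Subgroup Γ} {f : Γ → ℂ} (hf : Irr H f) : f 1 ≠ 0 := by
  intro h
  have h1 := hf.isChar.eq_zero_of_one h
  have h2 := hf.ip_self
  rw [ip_congr h1 h1, ip_zero_left] at h2
  exact zero_ne_one h2

theorem Irr.eq_of_ip_ne_zero {H : Subgroup Γ} {f g : Γ → ℂ} (hf : Irr H f) (hg : Irr H g)
    (h : ip H f g ≠ 0) : ∀ x ∈ H, f x = g x := by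
  obtain ⟨V, _, _, _, ρ, h0, hf⟩ := hf
  obtain ⟨W, _, _, _, σ, h1, hg⟩ := hg
  rw [ip_char_eq ρ σ hf hg] at h
  by_cases hE : Nonempty (Equiv σ ρ)
  · intro x hx
    rw [hf ⟨x, hx⟩, hg ⟨x, hx⟩, char_iso hE.some]
  · rw [not_nonempty_iff] at hE
    exact absurd (by rw [Module.finrank_zero_of_subsingleton, Nat.cast_zero]) h

theorem Irr.ip_eq {H : Subgroup Γ} {f g : Γ → ℂ} (hf : Irr H f) (hg : Irr H g) :
    ip H f g = if ∀ x ∈ H, f x = g x then 1 else 0 := by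
  split_ifs with h
  · rw [ip_congr h fun _ _ => rfl, hg.ip_self]
  · by_contra h'
    exact h (hf.eq_of_ip_ne_zero hg h')

theorem exists_conj_prodMap {H : Subgroup Γ} {V : Type} [AddCommGroup V] [Module ℂ V]
    (ρ : Representation ℂ H V) (W W' : Subrepresentation ρ) (h : IsCompl W W') :
    ∃ e : (W.toSubmodule × W'.toSubmodule) ≃ₗ[ℂ] V, ∀ x : H,
      ρ x = e.conj (LinearMap.prodMap (W.toRepresentation x) (W'.toRepresentation x)) := by
  have hc : IsCompl W.toSubmodule W'.toSubmodule := by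
    constructor
    · rw [disjoint_iff]
      exact congrArg Subrepresentation.toSubmodule h.inf_eq_bot
    · rw [codisjoint_iff]
      exact congrArg Subrepresentation.toSubmodule h.sup_eq_top
  refine ⟨Submodule.prodEquivOfIsCompl _ _ hc, fun x => ?_⟩
  ext v
  obtain ⟨w, rfl⟩ := (Submodule.prodEquivOfIsCompl _ _ hc).surjective v
  simp [LinearEquiv.conj_apply, Subrepresentation.toRepresentation]

theorem character_isCompl {H : Subgroup Γ} {V : Type} [AddCommGroup V] [Module ℂ V]
    [FiniteDimensional ℂ V] (ρ : Representation ℂ H V) (W W' : Subrepresentation ρ)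
    (h : IsCompl W W') (x : H) :
    ρ.character x = W.toRepresentation.character x + W'.toRepresentation.character x := by
  obtain ⟨e, he⟩ := exists_conj_prodMap ρ W W' h
  rw [Representation.character, he, LinearMap.trace_conj', LinearMap.trace_prodMap']
  rfl

theorem det_isCompl {H : Subgroup Γ} {V : Type} [AddCommGroup V] [Module ℂ V]
    [FiniteDimensional ℂ V] (ρ : Representation ℂ H V) (W W' : Subrepresentation ρ)
    (h : IsCompl W W') (x : H) :
    LinearMap.det (ρ x) =
      LinearMap.det (W.toRepresentation x) * LinearMap.det (W'.toRepresentation x) := by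
  obtain ⟨e, he⟩ := exists_conj_prodMap ρ W W' h
  rw [he, ← LinearMap.det_prodMap, LinearEquiv.conj_apply, LinearMap.comp_assoc]
  exact LinearMap.det_conj _ e

theorem rep_induction {H : Subgroup Γ}
    (P : ∀ (V : Type) [AddCommGroup V] [Module ℂ V] [FiniteDimensional ℂ V]
      (_ : Representation ℂ H V), Prop)
    (h0 : ∀ (V : Type) [AddCommGroup V] [Module ℂ V] [FiniteDimensional ℂ V]
      (ρ : Representation ℂ H V), Subsingleton V → P V ρ)
    (hi : ∀ (V : Type) [AddCommGroup V] [Module ℂ V] [FiniteDimensional ℂ V]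
      (ρ : Representation ℂ H V), ρ.IsIrreducible → P V ρ)
    (hs : ∀ (V : Type) [AddCommGroup V] [Module ℂ V] [FiniteDimensional ℂ V]
      (ρ : Representation ℂ H V) (W W' : Subrepresentation ρ), IsCompl W W' →
      P _ W.toRepresentation → P _ W'.toRepresentation → P V ρ) :
    ∀ (V : Type) [AddCommGroup V] [Module ℂ V] [FiniteDimensional ℂ V]
      (ρ : Representation ℂ H V), P V ρ := by
  intro V _ _ _ ρ
  induction hn : Module.finrank ℂ V using Nat.strong_induction_on generalizing V with
  | _ n ih =>
    by_cases hV : Subsingleton V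
    · exact h0 V ρ hV
    by_cases hI : ρ.IsIrreducible
    · exact hi V ρ hI
    have : Nontrivial (Subrepresentation ρ) := by
      refine ⟨⊥, ⊤, fun h => hV ?_⟩
      have h' : (⊥ : Submodule ℂ V) = ⊤ := congrArg Subrepresentation.toSubmodule h
      exact (Submodule.subsingleton_iff ℂ).mp (subsingleton_of_bot_eq_top h')
    have : ∃ W : Subrepresentation ρ, W ≠ ⊥ ∧ W ≠ ⊤ := by
      by_contra hcon
      push Not at hcon
      exact hI ⟨fun W => or_iff_not_imp_left.mpr (hcon W)⟩
    obtain ⟨W, hW0, hW1⟩ := this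
    have : NeZero (Nat.card H : ℂ) := ⟨card_ne_zero' H⟩
    have hss : IsSemisimpleRepresentation ρ := inferInstance
    obtain ⟨W', hW'⟩ := exists_isCompl W
    have key : ∀ U : Subrepresentation ρ, U ≠ ⊤ → Module.finrank ℂ U.toSubmodule < n := by
      intro U hU
      rw [← hn]
      refine Submodule.finrank_lt fun h => hU ?_
      exact Subrepresentation.toSubmodule_injective h
    refine hs V ρ W W' hW' (ih _ (key W hW1) _ _ rfl) (ih _ (key W' fun h => hW0 ?_) _ _ rfl)
    subst h
    simpa using hW'.inf_eq_bot

theorem IsChar.exists_decomp {H : Subgroup Γ} {f : Γ → ℂ} (hf : IsChar H f) :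
    ∃ (ι : Type) (_ : Fintype ι) (φ : ι → Γ → ℂ), (∀ i, Irr H (φ i)) ∧
      ∀ x ∈ H, f x = ∑ i, φ i x := by
  obtain ⟨V, _, _, _, ρ, hf⟩ := hf
  suffices h : ∃ (ι : Type) (_ : Fintype ι) (φ : ι → Γ → ℂ), (∀ i, Irr H (φ i)) ∧
      ∀ x : H, ρ.character x = ∑ i, φ i x by
    obtain ⟨ι, _, φ, h1, h2⟩ := h
    exact ⟨ι, _, φ, h1, fun x hx => (hf ⟨x, hx⟩).trans (h2 ⟨x, hx⟩)⟩
  clear hf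
  revert ρ
  refine fun ρ => rep_induction (H := H) (fun V _ _ _ ρ => ∃ (ι : Type) (_ : Fintype ι)
    (φ : ι → Γ → ℂ), (∀ i, Irr H (φ i)) ∧ ∀ x : H, ρ.character x = ∑ i, φ i x) ?_ ?_ ?_ V ρ
  · intro V _ _ _ ρ _
    refine ⟨Empty, inferInstance, fun i => i.elim, fun i => i.elim, fun x => ?_⟩
    rw [Representation.character, Subsingleton.elim (ρ x) 0]
    simp
  · intro V _ _ _ ρ hI
    refine ⟨Unit, inferInstance, fun _ x => if h : x ∈ H then ρ.character ⟨x, h⟩ else 0,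
      fun _ => ⟨V, _, _, inferInstance, ρ, hI, fun h => by simp⟩, fun x => by simp⟩
  · rintro V _ _ _ ρ W W' hc ⟨ι, _, φ, h1, h2⟩ ⟨κ, _, ψ, h3, h4⟩
    refine ⟨ι ⊕ κ, inferInstance, Sum.elim φ ψ, ?_, fun x => ?_⟩
    · rintro (i | i)
      exacts [h1 i, h3 i]
    · rw [character_isCompl ρ W W' hc, h2, h4, Fintype.sum_sum_type]
      rfl

theorem ip_add_right (H : Subgroup Γ) (f g g' : Γ → ℂ) :
    ip H f (g + g') = ip H f g + ip H f g' := by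
  rw [ip_comm, ip_add_left, ip_comm H g, ip_comm H g']

theorem IsChar.sub_irr {H : Subgroup Γ} {f g : Γ → ℂ} (hf : IsChar H f) (hg : Irr H g)
    (h : ip H f g ≠ 0) : ∃ f', IsChar H f' ∧ ∀ x ∈ H, f x = (g + f') x := by
  obtain ⟨ι, _, φ, h1, h2⟩ := hf.exists_decomp
  rw [ip_congr (f' := fun x => ∑ i, φ i x) (g' := g) h2 (fun _ _ => rfl), ip_sum_left] at h
  obtain ⟨i, -, hi⟩ := Finset.exists_ne_zero_of_sum_ne_zero h
  refine ⟨fun x => ∑ j ∈ Finset.univ.erase i, φ j x, IsChar.sum _ fun j _ => (h1 j).isChar,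
    fun x hx => ?_⟩
  rw [h2 x hx, Pi.add_apply, ← (h1 i).eq_of_ip_ne_zero hg hi x hx,
    Finset.add_sum_erase _ (fun j => φ j x) (Finset.mem_univ i)]

theorem IsChar.exists_irr_ip_ne_zero {H K : Subgroup Γ} {f g : Γ → ℂ} (hf : IsChar K f)
    (hHK : H ≤ K) (h : ip H f g ≠ 0) : ∃ φ, Irr K φ ∧ ip K f φ ≠ 0 ∧ ip H φ g ≠ 0 := by
  obtain ⟨ι, _, φ, h1, h2⟩ := hf.exists_decomp
  rw [ip_congr (f' := fun x => ∑ i, φ i x) (g' := g) (fun x hx => h2 x (hHK hx))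
    (fun _ _ => rfl), ip_sum_left] at h
  obtain ⟨i, -, hi⟩ := Finset.exists_ne_zero_of_sum_ne_zero h
  refine ⟨φ i, h1 i, ?_, hi⟩
  rw [ip_congr (f' := fun x => ∑ i, φ i x) (g' := φ i) h2 (fun _ _ => rfl), ip_sum_left]
  choose n hn using fun j => (h1 j).isChar.ip_nat (h1 i).isChar
  simp_rw [hn]
  rw [← Nat.cast_sum, Nat.cast_ne_zero]
  have : n i = 1 := by exact_mod_cast (hn i).symm.trans (h1 i).ip_self
  have h3 := Finset.single_le_sum (f := n) (fun _ _ => Nat.zero_le _) (Finset.mem_univ i)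
  omega

theorem IsChar.exists_irr {H : Subgroup Γ} {f : Γ → ℂ} (hf : IsChar H f)
    (h : f 1 ≠ 0) : ∃ φ, Irr H φ ∧ ip H f φ ≠ 0 := by
  have : ip H f f ≠ 0 := fun h' => h (hf.eq_zero_of_ip h' 1 H.one_mem)
  obtain ⟨φ, h1, h2, -⟩ := hf.exists_irr_ip_ne_zero le_rfl this
  exact ⟨φ, h1, h2⟩

theorem Irr.of_ip_self {H : Subgroup Γ} {f : Γ → ℂ} (hf : IsChar H f) (h : ip H f f = 1) :
    Irr H f := by
  have h0 : ip H f f ≠ 0 := h ▸ _root_.one_ne_zero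
  obtain ⟨φ, h1, h2, -⟩ := hf.exists_irr_ip_ne_zero le_rfl h0
  obtain ⟨f', h3, h4⟩ := hf.sub_irr h1 h2
  have h5 := h1.ip_self
  rw [ip_congr h4 h4, ip_add_left, ip_add_right, ip_add_right, ip_comm H f' φ, h5] at h
  obtain ⟨a, ha⟩ := h1.isChar.ip_nat h3
  obtain ⟨b, hb⟩ := h3.ip_nat h3
  have hb0 : b = 0 := by
    rw [ha, hb] at h
    have : 1 + a + (a + b) = 1 := by exact_mod_cast h
    omega
  rw [hb0, Nat.cast_zero] at hb
  refine h1.congr fun x hx => ?_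
  rw [h4 x hx, Pi.add_apply, h3.eq_zero_of_ip hb x hx, add_zero]

theorem irr_one (H : Subgroup Γ) : Irr H fun _ => 1 :=
  Irr.of_ip_self (isChar_one H) (by
    simp only [ip, mul_one, Finset.sum_const, Finset.card_univ, nsmul_eq_mul]
    rw [← Nat.card_eq_fintype_card, inv_mul_cancel₀ (card_ne_zero' H)])

theorem Irr.of_restrict {H K : Subgroup Γ} (hHK : H ≤ K) {f : Γ → ℂ} (hf : IsChar K f)
    (hi : Irr H f) : Irr K f := by
  obtain ⟨φ, h1, h2⟩ := hf.exists_irr hi.one_ne_zero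
  obtain ⟨f', h3, h4⟩ := hf.sub_irr h1 h2
  have h := hi.ip_self
  have h4' := fun x hx => h4 x (hHK hx)
  rw [ip_congr h4' h4', ip_add_left, ip_add_right, ip_add_right, ip_comm H f' φ] at h
  have h1H := h1.isChar.restrict hHK
  have h3H := h3.restrict hHK
  obtain ⟨a, ha⟩ := h1H.ip_nat h3H
  obtain ⟨b, hb⟩ := h3H.ip_nat h3H
  obtain ⟨c, hc⟩ := h1H.ip_nat h1H
  have hc0 : c ≠ 0 := by
    rintro rfl
    exact h1.one_ne_zero (h1H.eq_zero_of_ip (by simpa using hc) 1 H.one_mem)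
  have hb0 : b = 0 := by
    rw [ha, hb, hc] at h
    have : c + a + (a + b) = 1 := by exact_mod_cast h
    omega
  rw [hb0, Nat.cast_zero] at hb
  have h5 := h3.eq_zero_of_one (h3H.eq_zero_of_ip hb 1 H.one_mem)
  refine h1.congr fun x hx => ?_
  rw [h4 x hx, Pi.add_apply, h5 x hx, add_zero]

/-- `φ` is constant on the conjugacy classes of the subgroup `G`. -/
def IsClassFun (G : Subgroup Γ) (φ : Γ → ℂ) : Prop :=
  ∀ g ∈ G, ∀ x ∈ G, φ (g * x * g⁻¹) = φ x

theorem IsChar.isClassFun {H : Subgroup Γ} {f : Γ → ℂ} (hf : IsChar H f) : IsClassFun H f :=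
  fun _ hg _ hx => hf.conj hg hx

theorem nontrivial_of_isIrreducible {H : Subgroup Γ} {V : Type} [AddCommGroup V] [Module ℂ V]
    {ρ : Representation ℂ H V} (hI : ρ.IsIrreducible) : Nontrivial V := by
  by_contra hV
  rw [not_nontrivial_iff_subsingleton] at hV
  obtain ⟨a, b, hab⟩ := hI.toNontrivial
  refine hab (Subrepresentation.toSubmodule_injective ?_)
  exact Subsingleton.elim _ _

theorem eq_smul_id_of_commute {H : Subgroup Γ} {V : Type} [AddCommGroup V] [Module ℂ V]
    [FiniteDimensional ℂ V] {ρ : Representation ℂ H V} (hI : ρ.IsIrreducible)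
    {A : V →ₗ[ℂ] V} (hA : ∀ g : H, A * ρ g = ρ g * A) : ∃ c : ℂ, A = c • LinearMap.id := by
  obtain ⟨c, hc⟩ :=
    (IsIrreducible.algebraMap_intertwiningMap_bijective_of_isAlgClosed (ρ := ρ)).2 ⟨A, hA⟩
  exact ⟨c, (congrArg IntertwiningMap.toLinearMap hc).symm⟩

theorem class_sum_commute {G : Subgroup Γ} {φ : Γ → ℂ} (hφ : IsClassFun G φ) {V : Type}
    [AddCommGroup V] [Module ℂ V] (ρ : Representation ℂ G V) (g : G) :
    (∑ g : G, φ (g : Γ)⁻¹ • ρ g) * ρ g = ρ g * ∑ g : G, φ (g : Γ)⁻¹ • ρ g := by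
  have h1 : ∀ x : G, ρ g * ρ x = ρ (g * x * g⁻¹) * ρ g := by
    intro x
    rw [← map_mul, ← map_mul]
    simp
  rw [Finset.mul_sum, Finset.sum_mul, ← Equiv.sum_comp (MulAut.conj g).toEquiv]
  refine Finset.sum_congr rfl fun x _ => ?_
  rw [mul_smul_comm, h1, smul_mul_assoc]
  congr 1
  have := hφ g g.2 (x : Γ)⁻¹ (G.inv_mem x.2)
  rw [← this]
  simp [mul_assoc]

theorem class_sum_eq_zero {G : Subgroup Γ} {φ : Γ → ℂ} (hφ : IsClassFun G φ)
    (h : ∀ χ, Irr G χ → ip G φ χ = 0) (V : Type) [AddCommGroup V] [Module ℂ V]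
    [FiniteDimensional ℂ V] (ρ : Representation ℂ G V) :
    ∑ g : G, φ (g : Γ)⁻¹ • ρ g = 0 := by
  refine rep_induction (H := G) (fun V _ _ _ ρ => ∑ g : G, φ (g : Γ)⁻¹ • ρ g = 0) ?_ ?_ ?_ V ρ
  · intro V _ _ _ ρ _
    exact Subsingleton.elim _ _
  · intro V _ _ _ ρ hI
    obtain ⟨c, hA1⟩ := eq_smul_id_of_commute hI (class_sum_commute hφ ρ)
    have htr : LinearMap.trace ℂ V (∑ g : G, φ (g : Γ)⁻¹ • ρ g) = 0 := by
      have h2 := h (fun x => if hx : x ∈ G then ρ.character ⟨x, hx⟩ else 0)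
        ⟨V, _, _, inferInstance, ρ, hI, fun x => by simp⟩
      rw [ip_comm, ip, mul_eq_zero] at h2
      have h3 := h2.resolve_left (inv_ne_zero (card_ne_zero' G))
      rw [map_sum, ← h3]
      refine Finset.sum_congr rfl fun x _ => ?_
      simp [Representation.character, mul_comm]
    have := nontrivial_of_isIrreducible hI
    rw [hA1, map_smul, LinearMap.trace_id, smul_eq_mul, mul_eq_zero] at htr
    have hc0 := htr.resolve_right (Nat.cast_ne_zero.mpr Module.finrank_pos.ne')
    rw [hA1, hc0, zero_smul]
  · intro V _ _ _ ρ W W' hc h1 h2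
    have hcs : IsCompl W.toSubmodule W'.toSubmodule := by
      constructor
      · rw [disjoint_iff]
        exact congrArg Subrepresentation.toSubmodule hc.inf_eq_bot
      · rw [codisjoint_iff]
        exact congrArg Subrepresentation.toSubmodule hc.sup_eq_top
    ext v
    obtain ⟨w, hw, w', hw', rfl⟩ := Submodule.mem_sup.mp
      (hcs.sup_eq_top.symm ▸ Submodule.mem_top : v ∈ W.toSubmodule ⊔ W'.toSubmodule)
    have e1 := congrArg Subtype.val (LinearMap.congr_fun h1 ⟨w, hw⟩)
    have e2 := congrArg Subtype.val (LinearMap.congr_fun h2 ⟨w', hw'⟩)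
    simp only [LinearMap.sum_apply, LinearMap.smul_apply, Submodule.coe_sum,
      Submodule.coe_smul, LinearMap.zero_apply, Submodule.coe_zero] at e1 e2 ⊢
    simp only [map_add, smul_add, Finset.sum_add_distrib]
    change (∑ x : G, φ (x : Γ)⁻¹ • ρ x w) = 0 at e1
    change (∑ x : G, φ (x : Γ)⁻¹ • ρ x w') = 0 at e2
    rw [e1, e2, add_zero]

theorem IsClassFun.eq_zero {G : Subgroup Γ} {φ : Γ → ℂ} (hφ : IsClassFun G φ)
    (h : ∀ χ, Irr G χ → ip G φ χ = 0) : ∀ x ∈ G, φ x = 0 := by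
  intro x hx
  have h1 := class_sum_eq_zero hφ h (MonoidAlgebra ℂ G) (Representation.leftRegular ℂ G)
  have h2 := LinearMap.congr_fun h1 (MonoidAlgebra.single 1 1)
  have h3 := congrArg (fun f => MonoidAlgebra.coeff f (⟨x, hx⟩⁻¹ : G)) h2
  simpa [LinearMap.sum_apply, Finsupp.single_apply] using h3

/-- Extension of a function on a subgroup by zero. -/
def cut (G : Subgroup Γ) (f : Γ → ℂ) : Γ → ℂ := fun x => if x ∈ G then f x else 0

theorem cut_apply {G : Subgroup Γ} {f : Γ → ℂ} {x : Γ} (hx : x ∈ G) : cut G f x = f x :=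
  if_pos hx

theorem linearIndependent_irr (G : Subgroup Γ) :
    LinearIndependent ℂ (fun x : {f : Γ → ℂ | Irr G f ∧ ∀ x ∉ G, f x = 0} => (x : Γ → ℂ)) := by
  rw [linearIndependent_iff']
  intro s c hc i hi
  have h1 : ip G (fun x => ∑ j ∈ s, (c j • (j : Γ → ℂ)) x) i = 0 := by
    have : (fun x => ∑ j ∈ s, (c j • (j : Γ → ℂ)) x) = fun _ => 0 := by
      funext x
      rw [← Finset.sum_apply, hc]
      rfl
    rw [this, ip_zero_left]
  rw [ip_sum_left, Finset.sum_eq_single i] at h1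
  · rwa [ip_smul_left, i.2.1.ip_self, mul_one] at h1
  · intro j _ hj
    rw [ip_smul_left, j.2.1.ip_eq i.2.1, if_neg, mul_zero]
    intro h
    refine hj (Subtype.ext (funext fun x => ?_))
    by_cases hx : x ∈ G
    · exact h x hx
    · rw [j.2.2 x hx, i.2.2 x hx]
  · exact fun h => absurd hi h

theorem finite_irr (G : Subgroup Γ) : {f : Γ → ℂ | Irr G f ∧ ∀ x ∉ G, f x = 0}.Finite :=
  (linearIndependent_irr G).setFinite

/-- The irreducible characters of the subgroup `G`, extended by zero. -/
def irrs (G : Subgroup Γ) : Finset (Γ → ℂ) := (finite_irr G).toFinset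

theorem mem_irrs {G : Subgroup Γ} {f : Γ → ℂ} :
    f ∈ irrs G ↔ Irr G f ∧ ∀ x ∉ G, f x = 0 := by
  simp [irrs]

theorem cut_mem_irrs {G : Subgroup Γ} {f : Γ → ℂ} (h : Irr G f) : cut G f ∈ irrs G :=
  mem_irrs.mpr ⟨h.congr fun _ hx => cut_apply hx, fun _ hx => if_neg hx⟩

theorem IsClassFun.expansion {G : Subgroup Γ} {φ : Γ → ℂ} (hφ : IsClassFun G φ) :
    ∀ x ∈ G, φ x = ∑ χ ∈ irrs G, ip G φ χ * χ x := by
  set S : Γ → ℂ := fun x => ∑ χ ∈ irrs G, (ip G φ χ • χ) x with hS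
  have hc : IsClassFun G (φ + (-1 : ℂ) • S) := by
    intro g hg x hx
    simp only [Pi.add_apply, Pi.smul_apply, hS, hφ g hg x hx]
    congr 2
    refine Finset.sum_congr rfl fun χ hχ => ?_
    rw [(mem_irrs.mp hχ).1.isChar.conj hg hx]
  intro x hx
  have := hc.eq_zero (fun χ hχ => ?_) x hx
  · rw [Pi.add_apply, Pi.smul_apply, smul_eq_mul, neg_one_mul, add_neg_eq_zero] at this
    exact this
  · rw [ip_add_left, ip_smul_left, hS, ip_sum_left, Finset.sum_eq_single (cut G χ)]
    · have e : ∀ f, ip G f (cut G χ) = ip G f χ := fun f =>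
        ip_congr (fun _ _ => rfl) fun x hx => cut_apply hx
      rw [ip_smul_left, ip_comm G (cut G χ), e, e, hχ.ip_self]
      ring
    · intro ψ hψ hne
      rw [ip_smul_left, (mem_irrs.mp hψ).1.ip_eq hχ, if_neg, mul_zero]
      intro h
      refine hne (funext fun x => ?_)
      by_cases hx : x ∈ G
      · rw [h x hx, cut_apply hx]
      · rw [(mem_irrs.mp hψ).2 x hx, cut, if_neg hx]
    · exact fun h => absurd (cut_mem_irrs hχ) h

theorem IsClassFun.isChar {G : Subgroup Γ} {φ : Γ → ℂ} (hφ : IsClassFun G φ)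
    (h : ∀ χ, Irr G χ → ∃ n : ℕ, ip G φ χ = n) : IsChar G φ := by
  have : ∀ χ : Γ → ℂ, ∃ n : ℕ, χ ∈ irrs G → ip G φ χ = n := by
    intro χ
    by_cases hχ : χ ∈ irrs G
    · obtain ⟨n, hn⟩ := h χ (mem_irrs.mp hχ).1
      exact ⟨n, fun _ => hn⟩
    · exact ⟨0, fun h => absurd h hχ⟩
  choose n hn using this
  refine (IsChar.sum (irrs G) (f := fun χ x => n χ * χ x)
    fun χ hχ => (mem_irrs.mp hχ).1.isChar.nsmul (n χ)).congr fun x hx => ?_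
  rw [hφ.expansion x hx]
  exact Finset.sum_congr rfl fun χ hχ => by rw [hn χ hχ]

/-- The function on `G` induced from a function on `H`. -/
def indChar (H G : Subgroup Γ) (f : Γ → ℂ) (x : Γ) : ℂ :=
  (Nat.card H : ℂ)⁻¹ * ∑ g : Γ, if g ∈ G ∧ g * x * g⁻¹ ∈ H then f (g * x * g⁻¹) else 0

theorem indChar_conj (H : Subgroup Γ) {G : Subgroup Γ} (f : Γ → ℂ) {k : Γ} (hk : k ∈ G) (x : Γ) :
    indChar H G f (k * x * k⁻¹) = indChar H G f x := by
  unfold indChar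
  congr 1
  rw [← Equiv.sum_comp (Equiv.mulRight k⁻¹)]
  refine Finset.sum_congr rfl fun g _ => ?_
  have e : g * k⁻¹ * (k * x * k⁻¹) * (g * k⁻¹)⁻¹ = g * x * g⁻¹ := by group
  simp only [Equiv.coe_mulRight, e]
  rw [Subgroup.mul_mem_cancel_right G (G.inv_mem hk)]

theorem ip_indChar {H G : Subgroup Γ} (hHG : H ≤ G) (f : Γ → ℂ) {k : Γ → ℂ} (hk : IsClassFun G k) :
    ip G (indChar H G f) k = ip H f k := by
  rw [ip_eq_ite, ip_eq_ite]
  have e1 : (∑ x : Γ, if x ∈ G then indChar H G f x * k x⁻¹ else 0) =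
      (Nat.card H : ℂ)⁻¹ * ∑ g : Γ, ∑ x : Γ,
        if g ∈ G then (if g * x * g⁻¹ ∈ H then f (g * x * g⁻¹) * k (g * x * g⁻¹)⁻¹ else 0)
          else 0 := by
    rw [Finset.sum_comm, Finset.mul_sum]
    refine Finset.sum_congr rfl fun x _ => ?_
    by_cases hx : x ∈ G
    · rw [if_pos hx, indChar, mul_assoc, Finset.sum_mul]
      congr 1
      refine Finset.sum_congr rfl fun g _ => ?_
      by_cases hg : g ∈ G
      · have := hk g hg x⁻¹ (G.inv_mem hx)
        have e : (g * x * g⁻¹)⁻¹ = g * x⁻¹ * g⁻¹ := by group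
        rw [e, this]
        by_cases hm : g * x * g⁻¹ ∈ H <;> simp [hg, hm]
      · simp [hg]
    · rw [if_neg hx, Finset.sum_eq_zero, mul_zero]
      intro g _
      by_cases hg : g ∈ G
      · rw [if_pos hg, if_neg]
        intro h
        refine hx ?_
        have h1 := G.mul_mem (G.mul_mem (G.inv_mem hg) (hHG h)) hg
        have e : g⁻¹ * (g * x * g⁻¹) * g = x := by group
        rwa [e] at h1
      · rw [if_neg hg]
  have e2 : ∀ g : Γ, (∑ x : Γ, if g ∈ G then
      (if g * x * g⁻¹ ∈ H then f (g * x * g⁻¹) * k (g * x * g⁻¹)⁻¹ else 0) else 0) =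
      if g ∈ G then (∑ x : Γ, if x ∈ H then f x * k x⁻¹ else 0) else 0 := by
    intro g
    by_cases hg : g ∈ G
    · simp only [if_pos hg]
      exact Equiv.sum_comp (MulAut.conj g).toEquiv (fun x => if x ∈ H then f x * k x⁻¹ else 0)
    · simp [hg]
  rw [e1]
  simp_rw [e2]
  rw [← Finset.sum_filter, Finset.sum_const, nsmul_eq_mul]
  have e3 : ((Finset.univ.filter fun g : Γ => g ∈ G).card : ℂ) = Nat.card G := by
    rw [Nat.card_eq_fintype_card, Fintype.card_subtype]
  rw [e3]
  field_simp [card_ne_zero' G, card_ne_zero' H]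

theorem isClassFun_indChar (H G : Subgroup Γ) (f : Γ → ℂ) : IsClassFun G (indChar H G f) :=
  fun _ hg x _ => indChar_conj H f hg x

theorem IsChar.indChar {H G : Subgroup Γ} (hHG : H ≤ G) {f : Γ → ℂ} (hf : IsChar H f) :
    IsChar G (indChar H G f) := by
  refine (isClassFun_indChar H G f).isChar fun χ hχ => ?_
  rw [ip_indChar hHG f hχ.isChar.isClassFun]
  exact hf.ip_nat (hχ.isChar.restrict hHG)

theorem IsChar.conjTwist {H : Subgroup Γ} {f : Γ → ℂ} (hf : IsChar H f) {g : Γ}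
    (hg : ∀ x, g * x * g⁻¹ ∈ H ↔ x ∈ H) : IsChar H (fun x => f (g * x * g⁻¹)) := by
  obtain ⟨V, i1, i2, i3, ρ, hf⟩ := hf
  let e : H →* H :=
    { toFun := fun x => ⟨g * x * g⁻¹, (hg x).mpr x.2⟩
      map_one' := by simp
      map_mul' := fun x y => by simp [mul_assoc] }
  exact ⟨V, i1, i2, i3, ρ.comp e, fun h => hf (e h)⟩

theorem ip_conjTwist {H : Subgroup Γ} (f k : Γ → ℂ) {g : Γ}
    (hg : ∀ x, g * x * g⁻¹ ∈ H ↔ x ∈ H) :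
    ip H (fun x => f (g * x * g⁻¹)) (fun x => k (g * x * g⁻¹)) = ip H f k := by
  rw [ip_eq_ite, ip_eq_ite]
  congr 1
  rw [← Equiv.sum_comp (MulAut.conj g).toEquiv (fun x => if x ∈ H then f x * k x⁻¹ else 0)]
  refine Finset.sum_congr rfl fun x _ => ?_
  simp only [MulEquiv.toEquiv_eq_coe, EquivLike.coe_coe, MulAut.conj_apply, hg]
  rw [show g * x⁻¹ * g⁻¹ = (g * x * g⁻¹)⁻¹ by group]

theorem Irr.conjTwist {H : Subgroup Γ} {f : Γ → ℂ} (hf : Irr H f) {g : Γ}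
    (hg : ∀ x, g * x * g⁻¹ ∈ H ↔ x ∈ H) : Irr H (fun x => f (g * x * g⁻¹)) :=
  Irr.of_ip_self (hf.isChar.conjTwist hg) (by rw [ip_conjTwist f f hg, hf.ip_self])

theorem ip_map (H : Subgroup Γ) (σ : ℂ →+* ℂ) (f g : Γ → ℂ) :
    ip H (fun x => σ (f x)) (fun x => σ (g x)) = σ (ip H f g) := by
  simp [ip]

theorem exists_map_rep {H : Type*} [Group H] {V : Type} [AddCommGroup V] [Module ℂ V]
    [FiniteDimensional ℂ V] (ρ : Representation ℂ H V) (σ : ℂ →+* ℂ) :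
    ∃ (n : ℕ) (ρ' : Representation ℂ H (Fin n → ℂ)), ∀ h,
      ρ'.character h = σ (ρ.character h) ∧ LinearMap.det (ρ' h) = σ (LinearMap.det (ρ h)) := by
  let b := Module.finBasis ℂ V
  refine ⟨_,
    { toFun := fun h => Matrix.toLin' ((LinearMap.toMatrix b b (ρ h)).map σ)
      map_one' := by
        rw [map_one, LinearMap.toMatrix_one, Matrix.map_one σ (map_zero σ) (map_one σ),
          Matrix.toLin'_one]
        rfl
      map_mul' := fun x y => by
        rw [map_mul, LinearMap.toMatrix_mul, Matrix.map_mul, Matrix.toLin'_mul]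
        rfl }, fun h => ⟨?_, ?_⟩⟩
  · change LinearMap.trace ℂ _ (Matrix.toLin' _) = _
    rw [Matrix.trace_toLin'_eq, Representation.character, LinearMap.trace_eq_matrix_trace ℂ b]
    simp [Matrix.trace]
  · change LinearMap.det (Matrix.toLin' ((LinearMap.toMatrix b b (ρ h)).map σ)) = _
    rw [LinearMap.det_toLin', ← LinearMap.det_toMatrix b, RingHom.map_det]
    rfl

theorem IsChar.map {H : Subgroup Γ} {f : Γ → ℂ} (hf : IsChar H f) (σ : ℂ →+* ℂ) :
    IsChar H (fun x => σ (f x)) := by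
  obtain ⟨V, i1, i2, i3, ρ, hf⟩ := hf
  obtain ⟨n, ρ', h⟩ := exists_map_rep ρ σ
  exact ⟨_, inferInstance, inferInstance, inferInstance, ρ', fun x => by
    simp only [(h x).1, hf]⟩

theorem Irr.map {H : Subgroup Γ} {f : Γ → ℂ} (hf : Irr H f) (σ : ℂ →+* ℂ) :
    Irr H (fun x => σ (f x)) :=
  Irr.of_ip_self (hf.isChar.map σ) (by rw [ip_map, hf.ip_self, map_one])

/-- `N` is a normal subgroup of the subgroup `G`. -/
structure NormIn (N G : Subgroup Γ) : Prop where
  le : N ≤ G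
  conj_mem_iff : ∀ g ∈ G, ∀ x, g * x * g⁻¹ ∈ N ↔ x ∈ N

theorem NormIn.of_le {N K G : Subgroup Γ} (h : NormIn N G) (h1 : N ≤ K) (h2 : K ≤ G) :
    NormIn N K := ⟨h1, fun g hg => h.conj_mem_iff g (h2 hg)⟩

theorem NormIn.inf {N R G : Subgroup Γ} (h : NormIn N G) (h2 : R ≤ G) :
    NormIn (N ⊓ R) R :=
  ⟨inf_le_right, fun g hg x => by
    rw [Subgroup.mem_inf, Subgroup.mem_inf, h.conj_mem_iff g (h2 hg),
      Subgroup.mul_mem_cancel_right _ (R.inv_mem hg), Subgroup.mul_mem_cancel_left _ hg]⟩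

/-- `θ` is invariant under conjugation by `G` as a function on `N`. -/
def InvOn (G N : Subgroup Γ) (θ : Γ → ℂ) : Prop := ∀ g ∈ G, ∀ x ∈ N, θ (g * x * g⁻¹) = θ x

theorem ip_nat_add {H K : Subgroup Γ} (hHK : H ≤ K) {f g k : Γ → ℂ} (hf : IsChar K f)
    (hg : Irr K g) (h : ip K f g ≠ 0) (hk : IsChar H k) :
    ∃ n : ℕ, ip H f k = ip H g k + n := by
  obtain ⟨f', h1, h2⟩ := hf.sub_irr hg h
  obtain ⟨n, hn⟩ := (h1.restrict hHK).ip_nat hk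
  exact ⟨n, by rw [ip_congr (fun x hx => h2 x (hHK hx)) fun _ _ => rfl, ip_add_left, hn]⟩

theorem ip_ne_zero_of_constituent {H K : Subgroup Γ} (hHK : H ≤ K) {f g k : Γ → ℂ}
    (hf : IsChar K f) (hg : Irr K g) (h : ip K f g ≠ 0) (hk : IsChar H k) (h' : ip H g k ≠ 0) :
    ip H f k ≠ 0 := by
  obtain ⟨n, hn⟩ := ip_nat_add hHK hf hg h hk
  obtain ⟨m, hm⟩ := (hg.isChar.restrict hHK).ip_nat hk
  rw [hm] at h'
  rw [hn, hm, ← Nat.cast_add, Nat.cast_ne_zero]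
  have : m ≠ 0 := by exact_mod_cast h'
  omega

theorem IsChar.exists_decomp_ip {N : Subgroup Γ} {f : Γ → ℂ} (hf : IsChar N f) :
    ∃ (ι : Type) (_ : Fintype ι) (φ : ι → Γ → ℂ), (∀ i, Irr N (φ i)) ∧
      (∀ i, ip N f (φ i) ≠ 0) ∧ ∀ x ∈ N, f x = ∑ i, φ i x := by
  obtain ⟨ι, i1, φ, h1, h2⟩ := hf.exists_decomp
  refine ⟨ι, i1, φ, h1, fun i => ?_, h2⟩
  rw [ip_congr h2 fun _ _ => rfl, ip_sum_left]
  choose n hn using fun j => (h1 j).isChar.ip_nat (h1 i).isChar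
  simp_rw [hn]
  rw [← Nat.cast_sum, Nat.cast_ne_zero]
  have : n i = 1 := by exact_mod_cast (hn i).symm.trans (h1 i).ip_self
  have h3 := Finset.single_le_sum (f := n) (fun _ _ => Nat.zero_le _) (Finset.mem_univ i)
  omega

theorem IsChar.eq_nat_mul {N : Subgroup Γ} {f θ : Γ → ℂ} (hf : IsChar N f)
    (h : ∀ φ, Irr N φ → ip N f φ ≠ 0 → ∀ x ∈ N, φ x = θ x) :
    ∃ e : ℕ, ∀ x ∈ N, f x = e * θ x := by
  obtain ⟨ι, _, φ, h1, h3, h2⟩ := hf.exists_decomp_ip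
  refine ⟨Fintype.card ι, fun x hx => ?_⟩
  rw [h2 x hx, Finset.sum_congr rfl fun i _ => h (φ i) (h1 i) (h3 i) x hx]
  simp

theorem ip_nat_mul {N : Subgroup Γ} {f θ : Γ → ℂ} (hθ : Irr N θ) {e : ℕ}
    (h : ∀ x ∈ N, f x = e * θ x) : ip N f θ = e := by
  rw [ip_congr (f' := (e : ℂ) • θ) h fun _ _ => rfl, ip_smul_left, hθ.ip_self, mul_one]

theorem indChar_apply_normal {N T G : Subgroup Γ} (hN : NormIn N G) (hNT : N ≤ T)
    (f : Γ → ℂ) {x : Γ} (hx : x ∈ N) :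
    indChar T G f x = (Nat.card T : ℂ)⁻¹ * ∑ g : Γ, if g ∈ G then f (g * x * g⁻¹) else 0 := by
  unfold indChar
  congr 1
  refine Finset.sum_congr rfl fun g _ => ?_
  by_cases hg : g ∈ G
  · rw [if_pos ⟨hg, hNT ((hN.conj_mem_iff g hg x).mpr hx)⟩, if_pos hg]
  · rw [if_neg fun h => hg h.1, if_neg hg]

theorem ip_indChar_normal {N T G : Subgroup Γ} (hN : NormIn N G) (hNT : N ≤ T)
    (f k : Γ → ℂ) :
    ip N (indChar T G f) k = (Nat.card T : ℂ)⁻¹ *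
      ∑ g : Γ, if g ∈ G then ip N (fun x => f (g * x * g⁻¹)) k else 0 := by
  rw [ip_congr (f' := (Nat.card T : ℂ)⁻¹ • fun x => ∑ g : Γ,
    (fun g x => if g ∈ G then f (g * x * g⁻¹) else 0) g x)
    (fun x hx => indChar_apply_normal hN hNT f hx) fun _ _ => rfl, ip_smul_left, ip_sum_left]
  congr 1
  refine Finset.sum_congr rfl fun g _ => ?_
  by_cases hg : g ∈ G
  · simp [hg]
  · simp [hg, ip_zero_left]

theorem Irr.exists_conj {N G : Subgroup Γ} (hN : NormIn N G) {χ θ ψ : Γ → ℂ} (hχ : Irr G χ)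
    (hθ : Irr N θ) (hψ : Irr N ψ) (h1 : ip N χ θ ≠ 0) (h2 : ip N χ ψ ≠ 0) :
    ∃ g ∈ G, ∀ x ∈ N, θ (g * x * g⁻¹) = ψ x := by
  by_contra hcon
  push Not at hcon
  have h3 : ip G (indChar N G θ) χ ≠ 0 := by
    rwa [ip_indChar hN.le _ hχ.isChar.isClassFun, ip_comm]
  refine ip_ne_zero_of_constituent hN.le (hθ.isChar.indChar hN.le) hχ h3 hψ.isChar h2 ?_
  rw [ip_indChar_normal hN le_rfl, Finset.sum_eq_zero, mul_zero]
  intro g _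
  split_ifs with hg
  · rw [(hθ.conjTwist (hN.conj_mem_iff g hg)).ip_eq hψ, if_neg]
    intro h
    obtain ⟨x, hx, hne⟩ := hcon g hg
    exact hne (h x hx)
  · rfl

theorem Irr.eq_nat_mul {N G : Subgroup Γ} (hN : NormIn N G) {χ θ : Γ → ℂ} (hχ : Irr G χ)
    (hθ : Irr N θ) (hinv : InvOn G N θ) (h1 : ip N χ θ ≠ 0) :
    ∃ e : ℕ, e ≠ 0 ∧ ∀ x ∈ N, χ x = e * θ x := by
  obtain ⟨e, he⟩ := (hχ.isChar.restrict hN.le).eq_nat_mul (θ := θ) fun φ hφ h2 x hx => by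
    obtain ⟨g, hg, h⟩ := hχ.exists_conj hN hθ hφ h1 h2
    rw [← h x hx, hinv g hg x hx]
  refine ⟨e, ?_, he⟩
  rintro rfl
  exact h1 (by rw [ip_nat_mul hθ he, Nat.cast_zero])

theorem indChar_one_ne_zero {T G : Subgroup Γ} {η : Γ → ℂ} (h : η 1 ≠ 0) :
    indChar T G η 1 ≠ 0 := by
  unfold indChar
  refine mul_ne_zero (inv_ne_zero (card_ne_zero' T)) ?_
  simp only [mul_one, mul_inv_cancel, T.one_mem, and_true]
  rw [← Finset.sum_filter, Finset.sum_const, nsmul_eq_mul]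
  refine mul_ne_zero (Nat.cast_ne_zero.mpr (Finset.card_ne_zero.mpr ⟨1, ?_⟩)) h
  simp [G.one_mem]

theorem Irr.indChar_stabilizer {N T G : Subgroup Γ} (hN : NormIn N G) (hNT : N ≤ T)
    (hTG : T ≤ G) {θ η : Γ → ℂ} (hθ : Irr N θ)
    (hT : ∀ g ∈ G, g ∈ T ↔ ∀ x ∈ N, θ (g * x * g⁻¹) = θ x) (hη : Irr T η)
    (h : ip N η θ ≠ 0) : Irr G (indChar T G η) := by
  obtain ⟨e, he0, he⟩ := hη.eq_nat_mul (hN.of_le hNT hTG) hθ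
    (fun g hg => (hT g (hTG hg)).mp hg) h
  have hF := hη.isChar.indChar hTG
  have h1 : ip N (indChar T G η) θ = e := by
    rw [ip_indChar_normal hN hNT]
    have : ∀ g : Γ, (if g ∈ G then ip N (fun x => η (g * x * g⁻¹)) θ else 0) =
        if g ∈ T then (e : ℂ) else 0 := by
      intro g
      by_cases hg : g ∈ G
      · rw [if_pos hg, ip_congr (f' := (e : ℂ) • fun x => θ (g * x * g⁻¹)) (g' := θ)
          (fun x hx => he _ ((hN.conj_mem_iff g hg x).mpr hx)) fun _ _ => rfl, ip_smul_left,
          (hθ.conjTwist (hN.conj_mem_iff g hg)).ip_eq hθ]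
        simp only [hT g hg, mul_ite, mul_one, mul_zero]
      · rw [if_neg hg, if_neg fun h => hg (hTG h)]
    simp_rw [this]
    rw [← Finset.sum_filter, Finset.sum_const, nsmul_eq_mul]
    have e3 : ((Finset.univ.filter fun g : Γ => g ∈ T).card : ℂ) = Nat.card T := by
      rw [Nat.card_eq_fintype_card, Fintype.card_subtype]
    rw [e3, ← mul_assoc, inv_mul_cancel₀ (card_ne_zero' T), one_mul]
  refine Irr.of_ip_self hF ?_
  have h2 : ip G (indChar T G η) (indChar T G η) = ip T (indChar T G η) η := by
    rw [ip_indChar hTG _ (isClassFun_indChar T G η), ip_comm]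
  have h3 : ip T (indChar T G η) η ≠ 0 := fun h0 =>
    indChar_one_ne_zero hη.one_ne_zero (hF.eq_zero_of_ip (h2.trans h0) 1 G.one_mem)
  rw [h2]
  obtain ⟨Δ, hΔ, h4⟩ := (hF.restrict hTG).sub_irr hη h3
  have h5 : ip N Δ θ = 0 := by
    have := h1
    rw [ip_congr (fun x hx => h4 x (hNT hx)) fun _ _ => rfl, ip_add_left, ip_nat_mul hθ he] at this
    simpa using this
  rw [ip_congr h4 fun _ _ => rfl, ip_add_left, hη.ip_self, add_eq_left]
  by_contra h6
  exact ip_ne_zero_of_constituent hNT hΔ hη h6 hθ.isChar h h5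

theorem Irr.eq_indChar_stabilizer {N T G : Subgroup Γ} (hN : NormIn N G) (hNT : N ≤ T)
    (hTG : T ≤ G) {θ χ : Γ → ℂ} (hθ : Irr N θ)
    (hT : ∀ g ∈ G, g ∈ T ↔ ∀ x ∈ N, θ (g * x * g⁻¹) = θ x) (hχ : Irr G χ)
    (h : ip N χ θ ≠ 0) :
    ∃ η, Irr T η ∧ ip N η θ ≠ 0 ∧ ∀ x ∈ G, χ x = indChar T G η x := by
  obtain ⟨η, h1, h2, h3⟩ := (hχ.isChar.restrict hTG).exists_irr_ip_ne_zero hNT h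
  refine ⟨η, h1, h3, hχ.eq_of_ip_ne_zero (Irr.indChar_stabilizer hN hNT hTG hθ hT h1 h3) ?_⟩
  rwa [ip_comm, ip_indChar hTG _ hχ.isChar.isClassFun, ip_comm]

theorem ip_indChar_ne_zero {N T G : Subgroup Γ} (hTG : T ≤ G) (hNT : N ≤ T) {θ η : Γ → ℂ}
    (hθ : Irr N θ) (hη : Irr T η) (h : ip N η θ ≠ 0) : ip N (indChar T G η) θ ≠ 0 := by
  have hF := hη.isChar.indChar hTG
  have h2 : ip G (indChar T G η) (indChar T G η) = ip T (indChar T G η) η := by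
    rw [ip_indChar hTG _ (isClassFun_indChar T G η), ip_comm]
  have h3 : ip T (indChar T G η) η ≠ 0 := fun h0 =>
    indChar_one_ne_zero hη.one_ne_zero (hF.eq_zero_of_ip (h2.trans h0) 1 G.one_mem)
  exact ip_ne_zero_of_constituent hNT (hF.restrict hTG) hη h3 hθ.isChar h

theorem ip_cut {K H : Subgroup Γ} (hKH : K ≤ H) (f k : Γ → ℂ) :
    ip H f (cut K k) = (Nat.card K : ℂ) / Nat.card H * ip K f k := by
  rw [ip_eq_ite, ip_eq_ite, div_mul_eq_mul_div, mul_inv_cancel_left₀ (card_ne_zero' K),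
    div_eq_inv_mul]
  congr 1
  refine Finset.sum_congr rfl fun x _ => ?_
  by_cases hx : x ∈ K
  · rw [if_pos hx, if_pos (hKH hx), cut_apply (K.inv_mem hx)]
  · rw [if_neg hx, cut, if_neg fun h => hx (inv_inv x ▸ K.inv_mem h), mul_zero, ite_self]

/-- `M = NR` with `N` normal in `M`, and `θ` is an `M`-invariant irreducible character of `N`
which stays irreducible on `N ⊓ R`. -/
structure Supplement (N M R : Subgroup Γ) (θ : Γ → ℂ) : Prop where
  norm : NormIn N M
  le : R ≤ M
  card : Nat.card M * Nat.card (N ⊓ R : Subgroup Γ) = Nat.card N * Nat.card R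
  irr : Irr N θ
  inv : InvOn M N θ
  irr_inf : Irr (N ⊓ R) θ

namespace Supplement

variable {N M R : Subgroup Γ} {θ α ψ : Γ → ℂ}

theorem norm_inf (S : Supplement N M R θ) : NormIn (N ⊓ R) R := S.norm.inf S.le

theorem ip_indChar_eq (S : Supplement N M R θ) (α : Γ → ℂ) :
    ip N (indChar R M α) θ = ip (N ⊓ R) α θ := by
  have hc : IsClassFun M (cut N θ) := by
    intro g hg x _
    unfold cut
    simp only [S.norm.conj_mem_iff g hg]
    split_ifs with hx
    · exact S.inv g hg x hx
    · rfl
  have h1 := ip_indChar S.le α hc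
  rw [ip_cut S.norm.le, ip_congr (f' := α) (g' := cut (N ⊓ R) θ) (fun _ _ => rfl),
    ip_cut inf_le_right] at h1
  · have h2 : (Nat.card M : ℂ) * Nat.card (N ⊓ R : Subgroup Γ) = Nat.card N * Nat.card R := by
      exact_mod_cast S.card
    have hM := card_ne_zero' M
    have hN := card_ne_zero' N
    have hR := card_ne_zero' R
    rw [div_mul_eq_mul_div, div_mul_eq_mul_div, div_eq_div_iff hM hR] at h1
    refine mul_left_cancel₀ (mul_ne_zero hN hR) ?_
    linear_combination h1 + ip (N ⊓ R) α θ * h2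
  · intro x hx
    simp [cut, hx]

theorem eq_nat_mul_inf (S : Supplement N M R θ) (hα : Irr R α) (h : ip (N ⊓ R) α θ ≠ 0) :
    ∃ f : ℕ, f ≠ 0 ∧ ∀ x ∈ N ⊓ R, α x = f * θ x :=
  hα.eq_nat_mul S.norm_inf S.irr_inf (fun g hg x hx => S.inv g (S.le hg) x hx.1) h

theorem ip_inf_ne_zero (S : Supplement N M R θ) (hψ : Irr M ψ) (hψθ : ip N ψ θ ≠ 0)
    (hα : Irr R α) (h : ip R ψ α ≠ 0) : ip (N ⊓ R) α θ ≠ 0 := by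
  obtain ⟨e, he0, he⟩ := hψ.eq_nat_mul S.norm S.irr S.inv hψθ
  obtain ⟨φ, h1, h2⟩ := (hα.isChar.restrict inf_le_right).exists_irr (H := N ⊓ R)
    hα.one_ne_zero
  have h3 := ip_ne_zero_of_constituent inf_le_right (hψ.isChar.restrict S.le) hα h h1.isChar h2
  rw [ip_congr (H := N ⊓ R) (f' := (e : ℂ) • θ) (g' := φ) (fun x hx => he x hx.1) fun _ _ => rfl,
    ip_smul_left] at h3
  have h4 := S.irr_inf.eq_of_ip_ne_zero h1 (right_ne_zero_of_mul h3)
  rwa [ip_congr (g' := φ) (fun _ _ => rfl) h4]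

theorem ip_eq (S : Supplement N M R θ) (hψ : Irr M ψ) (hψθ : ip N ψ θ ≠ 0)
    (hα : Irr R α) (h : ip R ψ α ≠ 0) : ip N ψ θ = ip (N ⊓ R) α θ := by
  obtain ⟨e, he0, he⟩ := hψ.eq_nat_mul S.norm S.irr S.inv hψθ
  obtain ⟨f, hf0, hf⟩ := S.eq_nat_mul_inf hα (S.ip_inf_ne_zero hψ hψθ hα h)
  have h1 : ip M (indChar R M α) ψ ≠ 0 := by
    rwa [ip_indChar S.le _ hψ.isChar.isClassFun, ip_comm]
  obtain ⟨n, hn⟩ := ip_nat_add S.norm.le (hα.isChar.indChar S.le) hψ h1 S.irr.isChar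
  obtain ⟨m, hm⟩ := ip_nat_add inf_le_right (hψ.isChar.restrict S.le) hα h S.irr_inf.isChar
  rw [ip_nat_mul S.irr_inf (fun x hx => he x hx.1)] at hm
  rw [S.ip_indChar_eq] at hn
  rw [ip_nat_mul S.irr_inf hf, ip_nat_mul S.irr he] at *
  have h2 : f = e + n := by exact_mod_cast hn
  have h3 : e = f + m := by exact_mod_cast hm
  exact_mod_cast (by omega : e = f)

theorem eq_on (S : Supplement N M R θ) (hψ : Irr M ψ) (hψθ : ip N ψ θ ≠ 0)
    (hα : Irr R α) (h : ip R ψ α ≠ 0) : ∀ x ∈ R, ψ x = α x := by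
  obtain ⟨e, he0, he⟩ := hψ.eq_nat_mul S.norm S.irr S.inv hψθ
  obtain ⟨f, hf0, hf⟩ := S.eq_nat_mul_inf hα (S.ip_inf_ne_zero hψ hψθ hα h)
  have h1 := S.ip_eq hψ hψθ hα h
  rw [ip_nat_mul S.irr_inf hf, ip_nat_mul S.irr he] at h1
  obtain ⟨ψ', h2, h3⟩ := (hψ.isChar.restrict S.le).sub_irr hα h
  have h4 : ψ' 1 = 0 := by
    have := h3 1 R.one_mem
    rw [he 1 N.one_mem, Pi.add_apply, hf 1 (one_mem _), h1] at this
    simpa using this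
  intro x hx
  rw [h3 x hx, Pi.add_apply, h2.eq_zero_of_one h4 x hx, add_zero]

theorem unique (S : Supplement N M R θ) (hψ : Irr M ψ) (hψθ : ip N ψ θ ≠ 0)
    (hα : Irr R α) (h : ip R ψ α ≠ 0) {ψ' : Γ → ℂ} (hψ' : Irr M ψ') (hψθ' : ip N ψ' θ ≠ 0)
    (h' : ip R ψ' α ≠ 0) : ∀ x ∈ M, ψ' x = ψ x := by
  by_contra hne
  obtain ⟨f, hf0, hf⟩ := S.eq_nat_mul_inf hα (S.ip_inf_ne_zero hψ hψθ hα h)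
  have e1 := S.ip_eq hψ hψθ hα h
  have e2 := S.ip_eq hψ' hψθ' hα h'
  have h1 : ip M (indChar R M α) ψ ≠ 0 := by
    rwa [ip_indChar S.le _ hψ.isChar.isClassFun, ip_comm]
  have h1' : ip M (indChar R M α) ψ' ≠ 0 := by
    rwa [ip_indChar S.le _ hψ'.isChar.isClassFun, ip_comm]
  obtain ⟨Δ, hΔ, h2⟩ := (hα.isChar.indChar S.le).sub_irr hψ h1
  rw [ip_congr h2 fun _ _ => rfl, ip_add_left, ip_comm M ψ, hψ'.ip_eq hψ, if_neg hne,
    zero_add] at h1'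
  obtain ⟨n, hn⟩ := ip_nat_add S.norm.le hΔ hψ' h1' S.irr.isChar
  have h3 := S.ip_indChar_eq α
  rw [ip_congr (fun x hx => h2 x (S.norm.le hx)) fun _ _ => rfl, ip_add_left, hn, e1, e2,
    ip_nat_mul S.irr_inf hf] at h3
  have : f + (f + n) = f := by exact_mod_cast h3
  omega

theorem exists_extension (S : Supplement N M R θ) (hα : Irr R α) (h : ip (N ⊓ R) α θ ≠ 0) :
    ∃ ψ, Irr M ψ ∧ ip N ψ θ ≠ 0 ∧ ∀ x ∈ R, ψ x = α x := by
  rw [← S.ip_indChar_eq] at h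
  obtain ⟨ψ, h1, h2, h3⟩ := (hα.isChar.indChar S.le).exists_irr_ip_ne_zero S.norm.le h
  refine ⟨ψ, h1, h3, S.eq_on h1 h3 hα ?_⟩
  rwa [ip_comm, ← ip_indChar S.le _ h1.isChar.isClassFun]

end Supplement

theorem exists_eigenvalues_of_central {H : Subgroup Γ} (x : H) (hx : ∀ y : H, x * y = y * x)
    (V : Type) [AddCommGroup V] [Module ℂ V] [FiniteDimensional ℂ V]
    (ρ : Representation ℂ H V) :
    ∃ s : Multiset ℂ, (∀ k : ℕ, ρ.character (x ^ k) = (s.map fun z => z ^ k).sum) ∧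
      LinearMap.det (ρ x) = s.prod ∧ ∀ z ∈ s, z ^ orderOf x = 1 := by
  refine rep_induction (H := H) (fun V _ _ _ ρ => ∃ s : Multiset ℂ,
    (∀ k : ℕ, ρ.character (x ^ k) = (s.map fun z => z ^ k).sum) ∧
      LinearMap.det (ρ x) = s.prod ∧ ∀ z ∈ s, z ^ orderOf x = 1) ?_ ?_ ?_ V ρ
  · intro V _ _ _ ρ _
    refine ⟨0, fun k => ?_, ?_, by simp⟩
    · rw [Representation.character, Subsingleton.elim (ρ _) 0, map_zero]
      simp
    · rw [Subsingleton.elim (ρ x) LinearMap.id, LinearMap.det_id, Multiset.prod_zero]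
  · intro V _ _ _ ρ hI
    obtain ⟨c, hc⟩ := eq_smul_id_of_commute hI (A := ρ x) fun y => by
      rw [← map_mul, ← map_mul, hx]
    have hpow : ∀ k : ℕ, ρ (x ^ k) = c ^ k • LinearMap.id := by
      intro k
      rw [map_pow, hc, smul_pow]
      congr 1
      exact one_pow k
    refine ⟨Multiset.replicate (Module.finrank ℂ V) c, fun k => ?_, ?_, ?_⟩
    · rw [Representation.character, hpow, map_smul, LinearMap.trace_id]
      simp [mul_comm]
    · rw [hc, LinearMap.det_smul, LinearMap.det_id, mul_one, Multiset.prod_replicate]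
    · intro z hz
      rw [Multiset.eq_of_mem_replicate hz]
      have := nontrivial_of_isIrreducible hI
      obtain ⟨v, hv⟩ := exists_ne (0 : V)
      have h1 := hpow (orderOf x)
      rw [pow_orderOf_eq_one, map_one] at h1
      have h2 := LinearMap.congr_fun h1 v
      refine smul_left_injective ℂ hv ?_
      simpa using h2.symm
  · rintro V _ _ _ ρ W W' hc ⟨s, h1, h2, h3⟩ ⟨t, h4, h5, h6⟩
    refine ⟨s + t, fun k => ?_, ?_, ?_⟩
    · rw [character_isCompl ρ W W' hc, h1, h4, Multiset.map_add, Multiset.sum_add]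
    · rw [det_isCompl ρ W W' hc, h2, h5, Multiset.prod_add]
    · intro z hz
      rcases Multiset.mem_add.mp hz with hz | hz
      exacts [h3 z hz, h6 z hz]

theorem exists_eigenvalues {H : Subgroup Γ} {V : Type} [AddCommGroup V] [Module ℂ V]
    [FiniteDimensional ℂ V] (ρ : Representation ℂ H V) (x : H) :
    ∃ s : Multiset ℂ, (∀ k : ℕ, ρ.character (x ^ k) = (s.map fun z => z ^ k).sum) ∧
      LinearMap.det (ρ x) = s.prod ∧ ∀ z ∈ s, z ^ orderOf x = 1 := by
  have hle : Subgroup.zpowers (x : Γ) ≤ H := Subgroup.zpowers_le.mpr x.2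
  obtain ⟨s, h1, h2, h3⟩ := exists_eigenvalues_of_central
    (H := Subgroup.zpowers (x : Γ)) ⟨x, Subgroup.mem_zpowers _⟩ (by
      rintro ⟨_, k, rfl⟩
      exact Subtype.ext (Commute.self_zpow (x : Γ) k)) V
    (ρ.comp (Subgroup.inclusion hle))
  refine ⟨s, h1, h2, fun z hz => ?_⟩
  have := h3 z hz
  rwa [← Subgroup.orderOf_coe] at this ⊢

theorem Multiset.eq_nsmul_of_power_sums {s t : Multiset ℂ} {e : ℕ}
    (h : ∀ k : ℕ, (s.map fun z => z ^ k).sum = e * (t.map fun z => z ^ k).sum) : s = e • t := by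
  have hli := (linearIndependent_monoidHom (Multiplicative ℕ) ℂ).comp (powersHom ℂ)
    (powersHom ℂ).injective
  rw [linearIndependent_iff'] at hli
  set F := s.toFinset ∪ t.toFinset with hF
  have key : ∀ u : Multiset ℂ, u.toFinset ⊆ F → ∀ k : ℕ,
      (u.map fun z => z ^ k).sum = ∑ z ∈ F, (u.count z : ℂ) * z ^ k := by
    intro u hu k
    rw [Finset.sum_multiset_map_count]
    simp only [nsmul_eq_mul]
    refine Finset.sum_subset hu fun z _ hz => ?_
    rw [Multiset.count_eq_zero_of_notMem (by simpa using hz)]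
    simp
  have h1 := hli F (fun z => (s.count z : ℂ) - e * t.count z) ?_
  · ext z
    rw [Multiset.count_nsmul]
    by_cases hz : z ∈ F
    · have := h1 z hz
      rw [sub_eq_zero] at this
      exact_mod_cast this
    · simp only [hF, Finset.mem_union, Multiset.mem_toFinset, not_or] at hz
      rw [Multiset.count_eq_zero_of_notMem hz.1, Multiset.count_eq_zero_of_notMem hz.2, mul_zero]
  · funext k
    have := h k.toAdd
    rw [key s Finset.subset_union_left, key t Finset.subset_union_right, Finset.mul_sum,
      ← sub_eq_zero, ← Finset.sum_sub_distrib] at this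
    rw [Pi.zero_apply, ← this, Finset.sum_apply]
    refine Finset.sum_congr rfl fun z _ => ?_
    simp [powersHom_apply]
    ring

theorem IsChar.isIntegral {H : Subgroup Γ} {f : Γ → ℂ} (hf : IsChar H f) {x : Γ} (hx : x ∈ H) :
    IsIntegral ℤ (f x) := by
  obtain ⟨V, _, _, _, ρ, hf⟩ := hf
  obtain ⟨s, h1, -, h2⟩ := exists_eigenvalues ρ ⟨x, hx⟩
  have h3 := h1 1
  rw [pow_one, ← hf] at h3
  simp only [pow_one, Multiset.map_id'] at h3
  rw [h3]
  refine IsIntegral.multiset_sum fun z hz => ?_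
  refine IsIntegral.of_pow (orderOf_pos (⟨x, hx⟩ : H)) ?_
  rw [h2 z hz]
  exact isIntegral_one

theorem IsChar.map_eq_self {H : Subgroup Γ} {f : Γ → ℂ} (hf : IsChar H f) {p : ℕ}
    {σ : ℂ →+* ℂ} (hσ : ∀ (k : ℕ) (z : ℂ), z ^ p ^ k = 1 → σ z = z) {x : Γ} (hx : x ∈ H)
    {k : ℕ} (hk : x ^ p ^ k = 1) : σ (f x) = f x := by
  obtain ⟨V, _, _, _, ρ, hf⟩ := hf
  obtain ⟨s, h1, -, h2⟩ := exists_eigenvalues ρ ⟨x, hx⟩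
  have h3 := h1 1
  rw [pow_one, ← hf] at h3
  simp only [pow_one, Multiset.map_id'] at h3
  rw [h3, map_multiset_sum, Multiset.map_congr rfl, Multiset.map_id']
  intro z hz
  refine hσ k z ?_
  have : orderOf (⟨x, hx⟩ : H) ∣ p ^ k := orderOf_dvd_of_pow_eq_one (Subtype.ext hk)
  obtain ⟨m, hm⟩ := this
  rw [hm, pow_mul, h2 z hz, one_pow]

theorem det_eq_pow {H K : Subgroup Γ} {V W : Type} [AddCommGroup V] [Module ℂ V]
    [FiniteDimensional ℂ V] [AddCommGroup W] [Module ℂ W] [FiniteDimensional ℂ W]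
    (ρ : Representation ℂ H V) (τ : Representation ℂ K W) {e : ℕ} (x : H) (y : K)
    (h : ∀ k : ℕ, ρ.character (x ^ k) = e * τ.character (y ^ k)) :
    LinearMap.det (ρ x) = LinearMap.det (τ y) ^ e := by
  obtain ⟨s, h1, h2, -⟩ := exists_eigenvalues ρ x
  obtain ⟨t, h3, h4, -⟩ := exists_eigenvalues τ y
  have := Multiset.eq_nsmul_of_power_sums (s := s) (t := t) (e := e) fun k => by
    rw [← h1, ← h3, h]
  rw [h2, h4, this, Multiset.prod_nsmul]

theorem Irr.degree_dvd {H : Subgroup Γ} {f : Γ → ℂ} (hf : Irr H f) {d : ℕ} (hd : f 1 = d) :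
    d ∣ Nat.card H := by
  have hself := hf.ip_self
  have hfint := fun x hx => hf.isChar.isIntegral (x := x) hx
  have hcf := hf.isChar.isClassFun
  obtain ⟨V, _, _, _, ρ, hI, hf⟩ := hf
  obtain ⟨c, hc⟩ := eq_smul_id_of_commute hI (class_sum_commute hcf ρ)
  have hdV : (d : ℂ) = Module.finrank ℂ V := by
    rw [← hd, ← char_one ρ, ← hf]; rfl
  have hcd : c * d = Nat.card H := by
    have := congrArg (LinearMap.trace ℂ V) hc
    rw [map_smul, LinearMap.trace_id, map_sum, smul_eq_mul, ← hdV] at this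
    rw [← this]
    unfold ip at hself
    rw [inv_mul_eq_one₀ (card_ne_zero' H)] at hself
    rw [hself]
    refine Finset.sum_congr rfl fun x _ => ?_
    rw [map_smul, smul_eq_mul, mul_comm, hf x]
    rfl
  have hci : IsIntegral ℤ c := by
    let S := integralClosure ℤ ℂ
    let z : MonoidAlgebra S H :=
      ∑ g : H, MonoidAlgebra.single g ⟨f (g : Γ)⁻¹, hfint _ (H.inv_mem g.2)⟩
    have hz : IsIntegral S z := IsIntegral.of_finite S z
    let F := MonoidAlgebra.lift S (Module.End ℂ V) H ρ
    have hFz : F z = c • LinearMap.id := by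
      rw [← hc]
      simp only [F, z, map_sum, MonoidAlgebra.lift_single]
      rfl
    have h1 : IsIntegral S (F z) := hz.map F
    have h2 : IsIntegral S c := by
      rw [hFz] at h1
      have := nontrivial_of_isIrreducible hI
      have hinj : Function.Injective (IsScalarTower.toAlgHom S ℂ (Module.End ℂ V)) :=
        (algebraMap ℂ (Module.End ℂ V)).injective
      exact (isIntegral_algHom_iff _ hinj).mp h1
    exact isIntegral_trans c h2
  have hd0 : (d : ℂ) ≠ 0 := by
    rw [hdV]
    have := nontrivial_of_isIrreducible hI
    exact Nat.cast_ne_zero.mpr Module.finrank_pos.ne'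
  have hcq : c = ((Nat.card H / d : ℚ) : ℂ) := by
    push_cast
    rw [eq_div_iff hd0, hcd]
  rw [hcq] at hci
  have h3 : IsIntegral ℤ (Nat.card H / d : ℚ) :=
    (isIntegral_algebraMap_iff (algebraMap ℚ ℂ).injective).mp hci
  obtain ⟨n, hn⟩ := IsIntegrallyClosed.isIntegral_iff.mp h3
  have hd0' : (d : ℚ) ≠ 0 := by exact_mod_cast hd0
  rw [eq_div_iff hd0'] at hn
  have h4 : n * d = Nat.card H := by
    rw [eq_intCast] at hn
    exact_mod_cast hn
  exact_mod_cast (Dvd.intro_left n h4 : (d : ℤ) ∣ Nat.card H)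

theorem mul_pow_mem_of_commutator_mem {L : Type*} [Group L] (K : Subgroup L) [K.Normal] {a b : L}
    {m : ℕ} (h : a * b * a⁻¹ * b⁻¹ ∈ K) (ha : a ^ m ∈ K) (hb : b ^ m ∈ K) : (a * b) ^ m ∈ K := by
  rw [← QuotientGroup.eq_one_iff] at *
  simp only [QuotientGroup.mk_mul, QuotientGroup.mk_pow, QuotientGroup.mk_inv] at *
  have hc : Commute (a : L ⧸ K) b := by
    rw [mul_inv_eq_one, mul_inv_eq_iff_eq_mul] at h
    exact h
  rw [hc.mul_pow, ha, hb, mul_one]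

theorem eq_one_of_pow_eq_one {c : ℂˣ} {m n : ℕ} (h : m.Coprime n) (h1 : c ^ m = 1)
    (h2 : c ^ n = 1) : c = 1 := by
  have h3 := pow_gcd_eq_one.mpr ⟨h1, h2⟩
  rwa [h.gcd_eq_one, pow_one] at h3

theorem exists_dvd_mul_add_one {m n : ℕ} (hm : m ≠ 0) (h : n.Coprime m) :
    ∃ j, m ∣ n * j + 1 := by
  have : NeZero m := ⟨hm⟩
  refine ⟨(-((ZMod.unitOfCoprime n h)⁻¹ : (ZMod m)ˣ) : ZMod m).val, ?_⟩
  rw [← ZMod.natCast_eq_zero_iff]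
  push_cast
  rw [ZMod.natCast_zmod_val, mul_neg, ← ZMod.coe_unitOfCoprime n h, Units.mul_inv,
    neg_add_cancel]

/-- Intertwining elements over a group with abelian quotient of exponent `m` prime to `p` can be
normalized to a homomorphism by means of a determinant-like homomorphism `δ`. -/
theorem exists_hom_of_intertwiners {Γ U : Type*} [Group Γ] [Group U] {p a m : ℕ} (hm : m ≠ 0)
    (hmp : m.Coprime p) (κ : ℂˣ →* U) (hκ : ∀ c u, κ c * u = u * κ c) (δ : U →* ℂˣ)
    (hδ : ∀ c, δ (κ c) = c ^ p ^ a) {N M : Subgroup Γ} (hNM : N ≤ M)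
    (hN : ∀ g ∈ M, ∀ x ∈ N, g * x * g⁻¹ ∈ N) (hab : ∀ x ∈ M, ∀ y ∈ M, x * y * x⁻¹ * y⁻¹ ∈ N)
    (hpow : ∀ x ∈ M, x ^ m ∈ N) (r : Γ → U) (hr : ∀ x ∈ N, ∀ y ∈ N, r (x * y) = r x * r y)
    (hdet : ∀ x ∈ N, ∃ k, δ (r x) ^ p ^ k = 1)
    (hschur : ∀ A : U, (∀ n ∈ N, A * r n = r n * A) → ∃ c, A = κ c)
    (hκinj : Function.Injective κ)
    (hex : ∀ x ∈ M, ∃ X : U, ∀ n ∈ N, X * r n = r (x * n * x⁻¹) * X) :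
    ∃ F : M →* U, (∀ n (hn : n ∈ N), F ⟨n, hNM hn⟩ = r n) ∧ ∀ x, ∃ k, δ (F x) ^ p ^ k = 1 := by
  have hr1 : r 1 = 1 := by simpa using hr 1 N.one_mem 1 N.one_mem
  have hrinv : ∀ x ∈ N, r x⁻¹ = (r x)⁻¹ := fun x hx => by
    rw [eq_inv_iff_mul_eq_one, ← hr _ (N.inv_mem hx) _ hx, inv_mul_cancel, hr1]
  let E : Subgroup (Γ × U) :=
    { carrier := {e | e.1 ∈ M ∧ ∀ n ∈ N, e.2 * r n = r (e.1 * n * e.1⁻¹) * e.2}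
      one_mem' := ⟨M.one_mem, fun n _ => by simp⟩
      mul_mem' := by
        rintro ⟨x, X⟩ ⟨y, Y⟩ ⟨hx, hX⟩ ⟨hy, hY⟩
        refine ⟨M.mul_mem hx hy, fun n hn => ?_⟩
        simp only [Prod.mk_mul_mk] at hX hY ⊢
        rw [mul_assoc, hY n hn, ← mul_assoc, hX _ (hN y hy n hn), mul_assoc]
        congr 2
        group
      inv_mem' := by
        rintro ⟨x, X⟩ ⟨hx, hX⟩
        refine ⟨M.inv_mem hx, fun n hn => ?_⟩
        have hn' := hN _ (M.inv_mem hx) n hn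
        have := hX _ hn'
        simp only [Prod.inv_mk] at this hn' ⊢
        rw [show x * (x⁻¹ * n * x⁻¹⁻¹) * x⁻¹ = n by group] at this
        rw [inv_mul_eq_iff_eq_mul, ← mul_assoc, this, mul_inv_cancel_right] }
  let K : Subgroup E :=
    { carrier := {e | e.1.1 ∈ N ∧ e.1.2 = r e.1.1}
      one_mem' := ⟨N.one_mem, hr1.symm⟩
      mul_mem' := by
        rintro a b ⟨h1, h2⟩ ⟨h3, h4⟩
        refine ⟨N.mul_mem h1 h3, ?_⟩
        change a.1.2 * b.1.2 = r (a.1.1 * b.1.1)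
        rw [hr _ h1 _ h3, h2, h4]
      inv_mem' := by
        rintro a ⟨h1, h2⟩
        refine ⟨N.inv_mem h1, ?_⟩
        change a.1.2⁻¹ = r a.1.1⁻¹
        rw [hrinv _ h1, h2] }
  have hKn : K.Normal := by
    refine ⟨fun k hk g => ⟨hN _ g.2.1 _ hk.1, ?_⟩⟩
    change g.1.2 * k.1.2 * g.1.2⁻¹ = r (g.1.1 * k.1.1 * g.1.1⁻¹)
    rw [hk.2, g.2.2 _ hk.1, mul_inv_cancel_right]
  have hK : ∀ n (hn : n ∈ N), ∃ k : E, k ∈ K ∧ k.1 = (n, r n) := fun n hn =>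
    ⟨⟨(n, r n), hNM hn, fun x hx => by
      rw [← hr _ hn _ hx, ← hr _ (hN _ (hNM hn) _ hx) _ hn, inv_mul_cancel_right]⟩,
      ⟨hn, rfl⟩, rfl⟩
  let Good : E → Prop := fun e => (∃ k, δ e.1.2 ^ p ^ k = 1) ∧ e ^ m ∈ K
  have hpp : ∀ {u v : ℂˣ}, (∃ k, u ^ p ^ k = 1) → (∃ k, v ^ p ^ k = 1) →
      ∃ k, (u * v) ^ p ^ k = 1 := by
    rintro u v ⟨k, hk⟩ ⟨l, hl⟩
    refine ⟨k + l, ?_⟩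
    rw [mul_pow, pow_add, pow_mul, hk, one_pow, one_mul, mul_comm, pow_mul, hl, one_pow]
  have huniq : ∀ e f : E, Good e → Good f → e.1.1 = f.1.1 → e = f := by
    rintro e f ⟨⟨k, hk⟩, he⟩ ⟨⟨l, hl⟩, hf⟩ h1
    obtain ⟨c, hc⟩ := hschur (f.1.2⁻¹ * e.1.2) fun n hn => by
      rw [mul_assoc, e.2.2 n hn, h1, ← mul_assoc, ← mul_assoc]
      congr 1
      rw [inv_mul_eq_iff_eq_mul, ← mul_assoc, f.2.2 n hn, mul_inv_cancel_right]
    rw [inv_mul_eq_iff_eq_mul] at hc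
    have hcm : c ^ m = 1 := by
      have h2 : e.1.2 ^ m = r (e.1.1 ^ m) := he.2
      have h3 : f.1.2 ^ m = r (f.1.1 ^ m) := hf.2
      have hcomm : Commute f.1.2 (κ c) := (hκ c _).symm
      rw [hc, hcomm.mul_pow, h1, ← h3, mul_eq_left, ← map_pow] at h2
      exact hκinj (h2.trans (map_one κ).symm)
    have hcp : c ^ p ^ (a + k + l) = 1 := by
      have h2 : (c ^ p ^ a) = δ e.1.2 * (δ f.1.2)⁻¹ := by
        rw [hc, map_mul, hδ, mul_comm, inv_mul_cancel_left]
      rw [add_assoc, pow_add, pow_mul, h2, mul_pow, inv_pow, pow_add, pow_mul, hk, one_pow,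
        one_mul, mul_comm, pow_mul, hl, one_pow, inv_one]
    have hc1 : c = 1 := eq_one_of_pow_eq_one (hmp.pow_right _) hcm hcp
    rw [hc1, map_one, mul_one] at hc
    exact Subtype.ext (Prod.ext h1 hc)
  have hexists : ∀ x ∈ M, ∃ e : E, e.1.1 = x ∧ Good e := by
    intro x hx
    obtain ⟨X, hX⟩ := hex x hx
    let e0 : E := ⟨(x, X), hx, hX⟩
    have he0 : (∀ n ∈ N, X ^ m * r n = r (x ^ m * n * (x ^ m)⁻¹) * X ^ m) := (e0 ^ m).2.2
    have hxm := hpow x hx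
    obtain ⟨s, hs⟩ := hschur ((r (x ^ m))⁻¹ * X ^ m) fun n hn => by
      rw [mul_assoc, he0 n hn, hr _ (N.mul_mem hxm hn) _ (N.inv_mem hxm), hr _ hxm _ hn,
        hrinv _ hxm]
      group
    rw [inv_mul_eq_iff_eq_mul] at hs
    obtain ⟨t0, ht0⟩ := IsAlgClosed.exists_pow_nat_eq ((s⁻¹ : ℂˣ) : ℂ) (Nat.pos_of_ne_zero hm)
    have ht0' : t0 ≠ 0 := by
      rintro rfl
      rw [zero_pow hm] at ht0
      exact (s⁻¹).ne_zero ht0.symm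
    obtain ⟨t, rfl⟩ : ∃ t : ℂˣ, (t : ℂ) = t0 := ⟨Units.mk0 t0 ht0', rfl⟩
    have ht : t ^ m = s⁻¹ := Units.ext (by simpa using ht0)
    have h1 : (κ t * X) ^ m = r (x ^ m) := by
      have : Commute (κ t) X := hκ t X
      rw [this.mul_pow, hs, ← map_pow, ht, hκ, mul_assoc, ← map_mul, mul_inv_cancel, map_one,
        mul_one]
    obtain ⟨k, hk⟩ := hdet _ hxm
    rw [← h1, map_pow, ← pow_mul] at hk
    set u := δ (κ t * X)
    obtain ⟨j, q, hj⟩ := exists_dvd_mul_add_one (n := p ^ a * p ^ k) hm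
      (Nat.Coprime.mul_left (hmp.symm.pow_left _) (hmp.symm.pow_left _))
    have h2 : (κ (u ^ (p ^ k * j)) * (κ t * X)) ^ m = r (x ^ m) := by
      have : Commute (κ (u ^ (p ^ k * j))) (κ t * X) := hκ _ _
      rw [this.mul_pow, h1, ← map_pow, ← pow_mul, show p ^ k * j * m = m * p ^ k * j by ring,
        pow_mul, hk, one_pow, map_one, one_mul]
    have h3 : δ (κ (u ^ (p ^ k * j)) * (κ t * X)) ^ p ^ k = 1 := by
      rw [map_mul, hδ, ← pow_mul]
      change (_ * u) ^ _ = 1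
      rw [← pow_succ, show p ^ k * j * p ^ a + 1 = m * q by rw [← hj]; ring, ← pow_mul,
        show m * q * p ^ k = m * p ^ k * q by ring, pow_mul, hk, one_pow]
    refine ⟨⟨(x, κ (u ^ (p ^ k * j)) * (κ t * X)), hx, fun n hn => ?_⟩, rfl, ⟨k, h3⟩, hxm, h2⟩
    simp only
    rw [mul_assoc, mul_assoc, hX n hn, ← mul_assoc (κ t), hκ t, mul_assoc, ← mul_assoc (κ _),
      hκ _ (r _), mul_assoc]
  have hlmul : ∀ k e : E, k ∈ K → Good e → Good (k * e) := by
    rintro k e hk ⟨h1, h2⟩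
    refine ⟨?_, ?_⟩
    · change ∃ l, δ (k.1.2 * e.1.2) ^ p ^ l = 1
      rw [map_mul, hk.2]
      exact hpp (hdet _ hk.1) h1
    · rw [← QuotientGroup.eq_one_iff] at *
      rw [QuotientGroup.mk_pow] at h2 ⊢
      rw [QuotientGroup.mk_mul, hk, one_mul, h2]
  have hmul : ∀ e f : E, Good e → Good f → Good (e * f) := by
    intro e f he hf
    refine ⟨?_, ?_⟩
    · change ∃ l, δ (e.1.2 * f.1.2) ^ p ^ l = 1
      rw [map_mul]
      exact hpp he.1 hf.1
    · refine mul_pow_mem_of_commutator_mem K ?_ he.2 hf.2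
      have h1 : Good (e * f * e⁻¹) := by
        refine ⟨?_, ?_⟩
        · change ∃ l, δ (e.1.2 * f.1.2 * e.1.2⁻¹) ^ p ^ l = 1
          rw [map_mul, map_mul, map_inv, mul_comm, inv_mul_cancel_left]
          exact hf.1
        · rw [conj_pow]
          exact hKn.conj_mem _ hf.2 e
      obtain ⟨k, hk, hk1⟩ := hK _ (hab _ e.2.1 _ f.2.1)
      have h2 := huniq _ _ h1 (hlmul k f hk hf) (by
        change e.1.1 * f.1.1 * e.1.1⁻¹ = k.1.1 * f.1.1
        rw [hk1]
        simp)
      rw [h2, mul_inv_cancel_right]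
      exact hk
  choose F hF1 hF2 using fun x : M => hexists x x.2
  refine ⟨MonoidHom.mk' (fun x => (F x).1.2) fun x y => ?_, fun n hn => ?_, fun x => (hF2 x).1⟩
  · have := huniq _ _ (hF2 (x * y)) (hmul _ _ (hF2 x) (hF2 y)) (by
      rw [hF1]
      change _ = (F x).1.1 * (F y).1.1
      rw [hF1, hF1]; rfl)
    exact congrArg (fun e : E => e.1.2) this
  · obtain ⟨k, hk, hk1⟩ := hK n hn
    have := huniq _ k (hF2 ⟨n, hNM hn⟩) ⟨by rw [hk1]; exact hdet n hn, K.pow_mem hk m⟩ (by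
      rw [hF1, hk1])
    change (F ⟨n, hNM hn⟩).1.2 = r n
    rw [this, hk1]

theorem exists_linearEquiv_of_character_eq {H : Subgroup Γ} {V W : Type} [AddCommGroup V]
    [Module ℂ V] [FiniteDimensional ℂ V] [AddCommGroup W] [Module ℂ W] [FiniteDimensional ℂ W]
    {ρ : Representation ℂ H V} {τ : Representation ℂ H W} (hρ : ρ.IsIrreducible)
    (h : ∀ x, ρ.character x = τ.character x) :
    ∃ e : V ≃ₗ[ℂ] W, ∀ x v, e (ρ x v) = τ x (e v) := by
  let f : Γ → ℂ := fun x => if hx : x ∈ H then ρ.character ⟨x, hx⟩ else 0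
  have hf : ∀ x : H, f x = ρ.character x := fun x => by simp [f]
  have h1 := ip_char_eq τ ρ (fun x => (hf x).trans (h x)) hf
  rw [ip_char_eq ρ ρ hf hf, IsIrreducible.finrank_intertwiningMap_self, Nat.cast_inj] at h1
  have : Nontrivial (IntertwiningMap ρ τ) :=
    Module.nontrivial_of_finrank_pos (R := ℂ) (by omega)
  obtain ⟨F, hF⟩ := exists_ne (0 : IntertwiningMap ρ τ)
  have hinj := (IsIrreducible.injective_or_eq_zero F).resolve_right hF
  have hdim : Module.finrank ℂ V = Module.finrank ℂ W := by
    have := h 1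
    rw [char_one, char_one] at this
    exact_mod_cast this
  refine ⟨LinearEquiv.ofInjectiveOfFinrankEq F.toLinearMap hinj hdim, fun x v => ?_⟩
  exact LinearMap.congr_fun (F.isIntertwining' x) v

/-- The restriction of `f` to `H` is a character afforded by a representation all of whose
determinants have `p`-power order. -/
def PDet (p : ℕ) (H : Subgroup Γ) (f : Γ → ℂ) : Prop :=
  ∃ (V : Type) (_ : AddCommGroup V) (_ : Module ℂ V) (_ : FiniteDimensional ℂ V)
    (ρ : Representation ℂ H V), (∀ h : H, f h = ρ.character h) ∧
      ∀ h, ∃ k, LinearMap.det (ρ h) ^ p ^ k = 1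

theorem PDet.det_pow {p : ℕ} {H : Subgroup Γ} {f : Γ → ℂ} (hf : PDet p H f) {V : Type}
    [AddCommGroup V] [Module ℂ V] [FiniteDimensional ℂ V] {ρ : Representation ℂ H V}
    (hρ : ∀ h : H, f h = ρ.character h) (h : H) : ∃ k, LinearMap.det (ρ h) ^ p ^ k = 1 := by
  obtain ⟨W, _, _, _, τ, h1, h2⟩ := hf
  obtain ⟨k, hk⟩ := h2 h
  exact ⟨k, by rw [det_eq_pow ρ τ (e := 1) h h fun k => by simp [← hρ, ← h1], pow_one, hk]⟩

theorem PDet.isChar {p : ℕ} {H : Subgroup Γ} {f : Γ → ℂ} (hf : PDet p H f) : IsChar H f := by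
  obtain ⟨W, i1, i2, i3, τ, h1, h2⟩ := hf
  exact ⟨W, i1, i2, i3, τ, h1⟩

theorem PDet.map {p : ℕ} {H : Subgroup Γ} {f : Γ → ℂ} (hf : PDet p H f) (σ : ℂ →+* ℂ) :
    PDet p H (fun x => σ (f x)) := by
  obtain ⟨W, i1, i2, i3, τ, h1, h2⟩ := hf
  obtain ⟨n, ρ', h⟩ := exists_map_rep τ σ
  refine ⟨_, inferInstance, inferInstance, inferInstance, ρ', fun x => ?_, fun x => ?_⟩
  · simp only [(h x).1, h1]
  · obtain ⟨k, hk⟩ := h2 x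
    exact ⟨k, by rw [(h x).2, ← map_pow, hk, map_one]⟩

theorem PDet.conjTwist {p : ℕ} {H : Subgroup Γ} {f : Γ → ℂ} (hf : PDet p H f) {g : Γ}
    (hg : ∀ x, g * x * g⁻¹ ∈ H ↔ x ∈ H) : PDet p H (fun x => f (g * x * g⁻¹)) := by
  obtain ⟨V, i1, i2, i3, ρ, hf, hd⟩ := hf
  let e : H →* H :=
    { toFun := fun x => ⟨g * x * g⁻¹, (hg x).mpr x.2⟩
      map_one' := by simp
      map_mul' := fun x y => by simp [mul_assoc] }
  exact ⟨V, i1, i2, i3, ρ.comp e, fun h => hf (e h), fun h => hd (e h)⟩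

theorem det_smul_id {V : Type} [AddCommGroup V] [Module ℂ V] [FiniteDimensional ℂ V] (c : ℂ) :
    LinearMap.det (algebraMap ℂ (Module.End ℂ V) c) = c ^ Module.finrank ℂ V := by
  rw [Algebra.algebraMap_eq_smul_one, LinearMap.det_smul, map_one, mul_one]

theorem Irr.exists_extension_of_coprime {p a m : ℕ} (hm : m ≠ 0) (hmp : m.Coprime p)
    {N M : Subgroup Γ} {θ : Γ → ℂ} (hN : NormIn N M)
    (hab : ∀ x ∈ M, ∀ y ∈ M, x * y * x⁻¹ * y⁻¹ ∈ N) (hpow : ∀ x ∈ M, x ^ m ∈ N)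
    (hθ : Irr N θ) (h1 : θ 1 = (p ^ a : ℕ)) (hdet : PDet p N θ) (hinv : InvOn M N θ) :
    ∃ θ', PDet p M θ' ∧ ∀ x ∈ N, θ' x = θ x := by
  obtain ⟨V, i1, i2, i3, ρ, hI, hρ⟩ := hθ
  have hdim : Module.finrank ℂ V = p ^ a := by
    have := hρ 1
    rw [char_one] at this
    exact_mod_cast this.symm.trans h1
  let ρu : N →* (Module.End ℂ V)ˣ := MonoidHom.toHomUnits ρ
  let r : Γ → (Module.End ℂ V)ˣ := fun x => if hx : x ∈ N then ρu ⟨x, hx⟩ else 1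
  have hr : ∀ x (hx : x ∈ N), r x = ρu ⟨x, hx⟩ := fun x hx => dif_pos hx
  let κ : ℂˣ →* (Module.End ℂ V)ˣ := Units.map (algebraMap ℂ (Module.End ℂ V)).toMonoidHom
  let δ : (Module.End ℂ V)ˣ →* ℂˣ := Units.map LinearMap.det
  have hnt := nontrivial_of_isIrreducible hI
  obtain ⟨F, hF, hFd⟩ := exists_hom_of_intertwiners (Γ := Γ) (U := (Module.End ℂ V)ˣ) (p := p)
    (a := a) hm hmp κ
    (fun c u => Units.ext (Algebra.commutes (c : ℂ) (u : Module.End ℂ V))) δ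
    (fun c => Units.ext (by
      change LinearMap.det (algebraMap ℂ (Module.End ℂ V) c) = _
      rw [det_smul_id, hdim]; simp)) hN.le
    (fun g hg x hx => (hN.conj_mem_iff g hg x).mpr hx) hab hpow r
    (fun x hx y hy => by
      rw [hr x hx, hr y hy, hr _ (N.mul_mem hx hy), ← map_mul]; rfl)
    (fun x hx => by
      obtain ⟨k, hk⟩ := hdet.det_pow hρ ⟨x, hx⟩
      refine ⟨k, Units.ext ?_⟩
      rw [hr x hx]
      exact hk)
    (fun A hA => by
      obtain ⟨c, hc⟩ := eq_smul_id_of_commute hI (A := (A : Module.End ℂ V)) fun g => by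
        have := congrArg Units.val (hA g g.2)
        rw [hr g g.2] at this
        exact this
      have hc0 : c ≠ 0 := by
        rintro rfl
        rw [zero_smul] at hc
        exact A.ne_zero hc
      exact ⟨Units.mk0 c hc0, Units.ext hc⟩)
    (Units.map_injective (algebraMap ℂ (Module.End ℂ V)).injective)
    (fun x hx => by
      let cj : N →* N :=
        { toFun := fun n => ⟨x * n * x⁻¹, (hN.conj_mem_iff x hx n).mpr n.2⟩
          map_one' := by simp
          map_mul' := fun y z => by simp [mul_assoc] }
      obtain ⟨e, he⟩ := exists_linearEquiv_of_character_eq hI (τ := ρ.comp cj) fun n => by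
        have h2 := hρ (cj n)
        change _ = ρ.character (cj n)
        rw [← h2, ← hρ n]
        exact (hinv x hx n n.2).symm
      refine ⟨LinearMap.GeneralLinearGroup.ofLinearEquiv e, fun n hn => Units.ext ?_⟩
      rw [hr n hn, hr _ ((hN.conj_mem_iff x hx n).mpr hn)]
      exact LinearMap.ext fun v => he ⟨n, hn⟩ v)
  let ρ' : Representation ℂ M V := (Units.coeHom _).comp F
  refine ⟨fun x => if hx : x ∈ M then ρ'.character ⟨x, hx⟩ else 0,
    ⟨V, i1, i2, i3, ρ', fun h => by simp, fun h => ?_⟩, fun x hx => ?_⟩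
  · obtain ⟨k, hk⟩ := hFd h
    exact ⟨k, congrArg Units.val hk⟩
  · simp only [dif_pos (hN.le hx), hρ ⟨x, hx⟩]
    change LinearMap.trace ℂ V (F _ : Module.End ℂ V) = LinearMap.trace ℂ V (ρ _)
    rw [hF x hx, hr x hx]
    rfl

theorem PDet.eq_of_eq_on {p a m : ℕ} (hmp : m.Coprime p) {N M : Subgroup Γ} {f g : Γ → ℂ}
    (hN : NormIn N M) (hpow : ∀ x ∈ M, x ^ m ∈ N) (hf : PDet p M f) (hg : PDet p M g)
    (hi : Irr N f) (h1 : f 1 = (p ^ a : ℕ)) (h : ∀ x ∈ N, f x = g x) : ∀ x ∈ M, f x = g x := by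
  intro x hx
  obtain ⟨V, _, _, _, ρ, hρ, hρd⟩ := hf
  obtain ⟨W, _, _, _, τ, hτ, hτd⟩ := hg
  have hdim : Module.finrank ℂ V = p ^ a := by
    have := hρ 1
    rw [char_one] at this
    exact_mod_cast this.symm.trans h1
  let ι : N →* M := Subgroup.inclusion hN.le
  obtain ⟨V₀, _, _, _, ρ₀, hI, hρ₀⟩ := hi
  obtain ⟨e₁, he₁⟩ := exists_linearEquiv_of_character_eq hI (τ := (ρ.comp ι)) fun n => by
    rw [← hρ₀]; exact hρ (ι n)
  obtain ⟨e₂, he₂⟩ := exists_linearEquiv_of_character_eq hI (τ := (τ.comp ι)) fun n => by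
    rw [← hρ₀, h n n.2]; exact hτ (ι n)
  let X : M →* Module.End ℂ V₀ := (e₁.symm.conjRingEquiv : Module.End ℂ V →* Module.End ℂ V₀).comp ρ
  let Y : M →* Module.End ℂ V₀ := (e₂.symm.conjRingEquiv : Module.End ℂ W →* Module.End ℂ V₀).comp τ
  have hX : ∀ n : N, X (ι n) = ρ₀ n := fun n => LinearMap.ext fun v => by
    change e₁.symm (ρ (ι n) (e₁.symm.symm v)) = _
    rw [LinearEquiv.symm_symm, LinearEquiv.symm_apply_eq, he₁]; rfl
  have hY : ∀ n : N, Y (ι n) = ρ₀ n := fun n => LinearMap.ext fun v => by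
    change e₂.symm (τ (ι n) (e₂.symm.symm v)) = _
    rw [LinearEquiv.symm_symm, LinearEquiv.symm_apply_eq, he₂]; rfl
  obtain ⟨c, hc⟩ := eq_smul_id_of_commute hI (A := X (⟨x, hx⟩ : M)⁻¹ * Y ⟨x, hx⟩) fun n => by
    let n' : N := ⟨x * n * x⁻¹, (hN.conj_mem_iff x hx n).mpr n.2⟩
    have h2 : (⟨x, hx⟩ : M) * ι n = ι n' * ⟨x, hx⟩ := Subtype.ext (by simp [ι, n'])
    have h3 : (⟨x, hx⟩ : M)⁻¹ * ι n' = ι n * (⟨x, hx⟩ : M)⁻¹ := by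
      rw [inv_mul_eq_iff_eq_mul, ← mul_assoc, h2, mul_inv_cancel_right]
    rw [mul_assoc, ← hY, ← map_mul, h2, map_mul, hY n', ← hX n', ← mul_assoc, ← map_mul, h3,
      map_mul, mul_assoc, hX, hY]
  have hc' : Y ⟨x, hx⟩ = c • X ⟨x, hx⟩ := by
    have h2 := congrArg (X ⟨x, hx⟩ * ·) hc
    simp only [← mul_assoc, ← map_mul, mul_inv_cancel, map_one, one_mul] at h2
    rw [h2, mul_smul_comm]
    rfl
  have hcm : c ^ m = 1 := by
    have h2 : (⟨x, hx⟩ : M) ^ m = ι ⟨x ^ m, hpow x hx⟩ := rfl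
    have h3 : Y (⟨x, hx⟩ ^ m) = c ^ m • X (⟨x, hx⟩ ^ m) := by
      rw [map_pow, hc', smul_pow, map_pow]
    rw [h2, hX, hY] at h3
    have h4 := congrArg (ρ₀ ⟨x ^ m, hpow x hx⟩⁻¹ * ·) h3
    simp only [mul_smul_comm, ← map_mul, inv_mul_cancel, map_one] at h4
    have hnt := nontrivial_of_isIrreducible hI
    exact (smul_left_injective ℂ (_root_.one_ne_zero (α := Module.End ℂ V₀)))
      (h4.symm.trans (one_smul ℂ _).symm)
  have hdX : ∀ y, LinearMap.det (X y) = LinearMap.det (ρ y) := fun y =>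
    LinearMap.det_conj (ρ y) e₁.symm
  have hdY : ∀ y, LinearMap.det (Y y) = LinearMap.det (τ y) := fun y =>
    LinearMap.det_conj (τ y) e₂.symm
  have hcp : ∃ k, c ^ p ^ k = 1 := by
    obtain ⟨k, hk⟩ := hρd ⟨x, hx⟩
    obtain ⟨l, hl⟩ := hτd ⟨x, hx⟩
    rw [← hdX] at hk
    rw [← hdY, hc', LinearMap.det_smul, e₁.finrank_eq, hdim, mul_pow, ← pow_mul] at hl
    refine ⟨a + l + k, ?_⟩
    have := congrArg (· ^ p ^ k) hl
    simp only [mul_pow, one_pow] at this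
    rw [← pow_mul (LinearMap.det _), mul_comm (p ^ l), pow_mul (LinearMap.det _), hk, one_pow,
      mul_one] at this
    rw [pow_add, pow_add, pow_mul, this]
  obtain ⟨k, hk⟩ := hcp
  have hc1 : c = 1 := by
    have h3 := pow_gcd_eq_one.mpr ⟨hcm, hk⟩
    rwa [(hmp.pow_right k).gcd_eq_one, pow_one] at h3
  have h2 := hρ ⟨x, hx⟩
  have h3 := hτ ⟨x, hx⟩
  simp only at h2 h3
  rw [h2, h3]
  calc ρ.character ⟨x, hx⟩ = LinearMap.trace ℂ _ (X ⟨x, hx⟩) :=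
        (LinearMap.trace_conj' (ρ ⟨x, hx⟩) e₁.symm).symm
    _ = LinearMap.trace ℂ _ (Y ⟨x, hx⟩) := by rw [hc', hc1, one_smul]
    _ = _ := LinearMap.trace_conj' (τ ⟨x, hx⟩) e₂.symm

theorem NormIn.normal {N M : Subgroup Γ} (h : NormIn N M) : (N.subgroupOf M).Normal :=
  ⟨fun n hn g => by
    rw [Subgroup.mem_subgroupOf] at hn ⊢
    exact (h.conj_mem_iff g g.2 n).mpr hn⟩

theorem NormIn.pow_relIndex_mem {N M : Subgroup Γ} (h : NormIn N M) {x : Γ} (hx : x ∈ M) :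
    x ^ N.relIndex M ∈ N := by
  have := h.normal
  have h1 := (N.subgroupOf M).pow_index_mem ⟨x, hx⟩
  exact h1

theorem NormIn.relIndex_dvd {N M R : Subgroup Γ} (h : NormIn N M) (hR : R ≤ M) :
    N.relIndex R ∣ N.relIndex M := by
  have := h.normal
  rw [← Subgroup.relIndex_subgroupOf hR]
  exact Subgroup.relIndex_dvd_index_of_normal (N.subgroupOf M) (R.subgroupOf M)

theorem relIndex_mul_relIndex_inf {N M R : Subgroup Γ} (hN : N ≤ M) (hR : R ≤ M) :
    N.relIndex R * R.relIndex M = (N ⊓ R).relIndex N * N.relIndex M := by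
  rw [← Subgroup.inf_relIndex_right N R, Subgroup.relIndex_mul_relIndex _ _ _ inf_le_right hR,
    Subgroup.relIndex_mul_relIndex _ _ _ inf_le_left hN]

theorem card_mul_relIndex {N M : Subgroup Γ} (h : N ≤ M) :
    Nat.card N * N.relIndex M = Nat.card M := by
  rw [← Subgroup.relIndex_bot_left, ← Subgroup.relIndex_bot_left,
    Subgroup.relIndex_mul_relIndex _ _ _ bot_le h]

theorem exists_sylow_le (p : ℕ) [Fact p.Prime] (H : Subgroup Γ) :
    ∃ R ≤ H, IsPGroup p R ∧ ¬ p ∣ R.relIndex H := by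
  let P : Sylow p H := default
  refine ⟨(P : Subgroup H).map H.subtype, Subgroup.map_subtype_le _, P.isPGroup'.map _, ?_⟩
  rw [Subgroup.relIndex, Subgroup.subgroupOf, Subgroup.comap_map_eq_self_of_injective
    H.subtype_injective]
  exact P.not_dvd_index

/-- `σ` fixes all roots of unity of `p`-power order. -/
def FixesRoots (p : ℕ) (σ : ℂ →+* ℂ) : Prop := ∀ (k : ℕ) (z : ℂ), z ^ p ^ k = 1 → σ z = z

/-- Irreducible characters of `N` with `p`-power determinantal order that restrict irreducibly to
all subgroups of index prime to `p` and have no Galois conjugates over the `p`-cyclotomic field. -/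
structure Special (p : ℕ) (N : Subgroup Γ) (θ : Γ → ℂ) : Prop where
  irr : Irr N θ
  det : PDet p N θ
  sylow : ∀ R ≤ N, ¬ p ∣ R.relIndex N → Irr R θ
  gal : ∀ σ, FixesRoots p σ → ∀ x ∈ N, σ (θ x) = θ x

theorem exists_pow_mem_of_isPGroup {p : ℕ} {R : Subgroup Γ} (hR : IsPGroup p R) {x : Γ}
    (hx : x ∈ R) : ∃ k, x ^ p ^ k = 1 := by
  obtain ⟨k, hk⟩ := hR ⟨x, hx⟩
  exact ⟨k, congrArg Subtype.val hk⟩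

namespace Special

variable {p : ℕ} {N M : Subgroup Γ} {θ ψ : Γ → ℂ}

theorem exists_degree [hp : Fact p.Prime] (h : Special p N θ) : ∃ a : ℕ, θ 1 = (p ^ a : ℕ) := by
  obtain ⟨R, hR, hRp, hRi⟩ := exists_sylow_le p N
  obtain ⟨d, hd⟩ := h.irr.isChar.one_nat
  obtain ⟨n, hn⟩ := IsPGroup.iff_card.mp hRp
  have := (h.sylow R hR hRi).degree_dvd hd
  rw [hn, Nat.dvd_prime_pow hp.out] at this
  obtain ⟨a, -, rfl⟩ := this
  exact ⟨a, hd⟩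

theorem supplement {k : ℕ} [hp : Fact p.Prime] (h : Special p N θ) (hN : NormIn N M)
    (hk : N.relIndex M = p ^ k) (hinv : InvOn M N θ) {R : Subgroup Γ} (hR : R ≤ M)
    (hRi : ¬ p ∣ R.relIndex M) : Supplement N M R θ := by
  have h1 := relIndex_mul_relIndex_inf hN.le hR
  have h2 : N.relIndex R = N.relIndex M := by
    refine Nat.dvd_antisymm (hN.relIndex_dvd hR) ?_
    rw [hk] at h1 ⊢
    exact (((Nat.Prime.coprime_iff_not_dvd hp.out).mpr hRi).pow_left k).dvd_of_dvd_mul_right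
      (Dvd.intro_left _ h1.symm)
  have h3 : (N ⊓ R).relIndex N = R.relIndex M := by
    rw [h2, mul_comm] at h1
    exact (Nat.eq_of_mul_eq_mul_right (by rw [hk]; exact pow_pos hp.out.pos k) h1).symm
  refine ⟨hN, hR, ?_, h.irr, hinv, h.sylow _ inf_le_left (by rwa [h3])⟩
  rw [← card_mul_relIndex hN.le, ← card_mul_relIndex (inf_le_right : N ⊓ R ≤ R),
    Subgroup.inf_relIndex_right, h2]
  ring

theorem of_relIndex_eq_pow {k : ℕ} [hp : Fact p.Prime] (h : Special p N θ) (hN : NormIn N M)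
    (hk : N.relIndex M = p ^ k) (hinv : InvOn M N θ) (hψ : Irr M ψ) (hψθ : ip N ψ θ ≠ 0) :
    Special p M ψ := by
  have hsyl : ∀ R ≤ M, ¬ p ∣ R.relIndex M → Irr R ψ := fun R hR hRi => by
    obtain ⟨α, hα, hne⟩ := (hψ.isChar.restrict hR).exists_irr hψ.one_ne_zero
    exact hα.congr ((h.supplement hN hk hinv hR hRi).eq_on hψ hψθ hα hne)
  refine ⟨hψ, ?_, hsyl, ?_⟩
  · obtain ⟨e, -, he⟩ := hψ.eq_nat_mul hN h.irr hinv hψθ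
    obtain ⟨W, _, _, _, τ, hτ, hτd⟩ := h.det
    obtain ⟨V, i1, i2, i3, ρ, -, hρ⟩ := hψ
    refine ⟨V, i1, i2, i3, ρ, hρ, fun x => ?_⟩
    have hx : (x : Γ) ^ p ^ k ∈ N := hk ▸ hN.pow_relIndex_mem x.2
    obtain ⟨l, hl⟩ := hτd ⟨_, hx⟩
    refine ⟨k + l, ?_⟩
    rw [pow_add, pow_mul, ← map_pow LinearMap.det, ← map_pow ρ,
      det_eq_pow ρ τ (e := e) (x ^ p ^ k) ⟨_, hx⟩ fun j => ?_, ← pow_mul, mul_comm, pow_mul, hl,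
      one_pow]
    rw [← hρ, ← hτ]
    exact he _ (N.pow_mem hx j)
  · intro σ hσ x hx
    obtain ⟨R, hR, hRp, hRi⟩ := exists_sylow_le p M
    have hRψ := hsyl R hR hRi
    have heq : ∀ x ∈ R, σ (ψ x) = ψ x := fun x hx => by
      obtain ⟨j, hj⟩ := exists_pow_mem_of_isPGroup hRp hx
      exact hψ.isChar.map_eq_self hσ (hR hx) hj
    refine (h.supplement hN hk hinv hR hRi).unique hψ hψθ hRψ ?_ (hψ.map σ) ?_ ?_ x hx
    · rw [hRψ.ip_self]; exact _root_.one_ne_zero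
    · rw [ip_congr (g' := fun x => σ (θ x)) (fun _ _ => rfl) fun x hx => (h.gal σ hσ x hx).symm,
        ip_map]
      simpa using hψθ
    · rw [ip_congr heq fun _ _ => rfl, hRψ.ip_self]; exact _root_.one_ne_zero

theorem exists_extension [hp : Fact p.Prime] (h : Special p N θ) (hN : NormIn N M)
    (hm : ¬ p ∣ N.relIndex M) (hab : ∀ x ∈ M, ∀ y ∈ M, x * y * x⁻¹ * y⁻¹ ∈ N)
    {G : Subgroup Γ} (hNG : NormIn N G) (hMG : NormIn M G) (hinv : InvOn G N θ) :
    ∃ θ', Special p M θ' ∧ (∀ x ∈ N, θ' x = θ x) ∧ InvOn G M θ' := by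
  obtain ⟨a, ha⟩ := h.exists_degree
  have hm0 : N.relIndex M ≠ 0 := fun h0 => hm (h0 ▸ dvd_zero p)
  have hmp : (N.relIndex M).Coprime p := ((Nat.Prime.coprime_iff_not_dvd hp.out).mpr hm).symm
  have hpow : ∀ x ∈ M, x ^ N.relIndex M ∈ N := fun x hx => hN.pow_relIndex_mem hx
  obtain ⟨θ', hd, he⟩ := h.irr.exists_extension_of_coprime hm0 hmp hN hab hpow ha h.det
    fun g hg => hinv g (hMG.le hg)
  have hi : Irr N θ' := h.irr.congr he
  have h1 : θ' 1 = (p ^ a : ℕ) := (he 1 N.one_mem).trans ha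
  refine ⟨θ', ⟨hi.of_restrict hN.le hd.isChar, hd, fun R hR hRi => ?_, fun σ hσ x hx => ?_⟩, he,
    fun g hg x hx => ?_⟩
  · refine Irr.of_restrict (H := N ⊓ R) inf_le_right (hd.isChar.restrict hR)
      ((h.sylow _ inf_le_left fun hdvd => ?_).congr fun x hx => he x hx.1)
    have h2 := relIndex_mul_relIndex_inf hN.le hR
    have h3 : p ∣ N.relIndex R * R.relIndex M := h2 ▸ hdvd.mul_right _
    rcases hp.out.dvd_mul.mp h3 with h4 | h4
    · exact hm (h4.trans (hN.relIndex_dvd hR))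
    · exact hRi h4
  · exact (hd.eq_of_eq_on hmp hN hpow (hd.map σ) hi h1 (fun x hx => by
      rw [he x hx, h.gal σ hσ x hx]) x hx).symm
  · exact (hd.eq_of_eq_on hmp hN hpow (hd.conjTwist (hMG.conj_mem_iff g hg)) hi h1 (fun x hx => by
      rw [he x hx, he _ ((hNG.conj_mem_iff g hg x).mpr hx), hinv g hg x hx]) x hx).symm

end Special

theorem special_bot (p : ℕ) : Special p (⊥ : Subgroup Γ) fun _ => 1 := by
  refine ⟨irr_one ⊥, ⟨ℂ, inferInstance, inferInstance, inferInstance,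
    Representation.trivial ℂ _ ℂ, fun x => ?_, fun x => ⟨0, ?_⟩⟩, fun R hR _ => ?_,
    fun σ _ x _ => map_one σ⟩
  · change 1 = LinearMap.trace ℂ ℂ (LinearMap.id)
    simp
  · change LinearMap.det (LinearMap.id) ^ _ = _
    simp
  · rw [le_bot_iff.mp hR]; exact irr_one ⊥

theorem exists_normal_isPGroup (Q : Type*) [Group Q] [Finite Q] [Group.IsSolvable Q]
    [Nontrivial Q] :
    ∃ (r : ℕ) (A : Subgroup Q), r.Prime ∧ A.Normal ∧ A ≠ ⊥ ∧ IsPGroup r A ∧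
      ∀ x ∈ A, ∀ y ∈ A, x * y = y * x := by
  have hs : ∃ n, derivedSeries Q n = ⊥ := (Group.isSolvable_def Q).mp inferInstance
  obtain ⟨n, hn⟩ : ∃ n, Nat.find hs = n + 1 :=
    Nat.exists_eq_succ_of_ne_zero fun h => by
      have := Nat.find_spec hs
      rw [h, derivedSeries_zero] at this
      exact top_ne_bot this
  set B := derivedSeries Q n with hB
  have hB0 : B ≠ ⊥ := Nat.find_min hs (by omega)
  have hBc : ∀ x ∈ B, ∀ y ∈ B, x * y = y * x := by
    intro x hx y hy
    have h1 := Nat.find_spec hs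
    rw [hn, derivedSeries_succ] at h1
    have h2 := Subgroup.commutator_mem_commutator hx hy
    rw [h1, Subgroup.mem_bot, commutatorElement_eq_one_iff_mul_comm] at h2
    exact h2
  have hBn : B.Normal := inferInstance
  have hcard : Nat.card B ≠ 1 := fun h => hB0 (Subgroup.card_eq_one.mp h)
  obtain ⟨r, hr, hrB⟩ := Nat.exists_prime_and_dvd hcard
  have : Fact r.Prime := ⟨hr⟩
  let A : Subgroup Q :=
    { carrier := {x | x ∈ B ∧ ∃ k, x ^ r ^ k = 1}
      one_mem' := ⟨B.one_mem, 0, one_pow _⟩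
      mul_mem' := by
        rintro x y ⟨hx, k, hk⟩ ⟨hy, l, hl⟩
        refine ⟨B.mul_mem hx hy, k + l, ?_⟩
        rw [Commute.mul_pow (hBc x hx y hy), pow_add, pow_mul, hk, one_pow, one_mul,
          mul_comm (r ^ k), pow_mul, hl, one_pow]
      inv_mem' := by
        rintro x ⟨hx, k, hk⟩
        exact ⟨B.inv_mem hx, k, by rw [inv_pow, hk, inv_one]⟩ }
  refine ⟨r, A, hr, ⟨?_⟩, ?_, ?_, fun x hx y hy => hBc x hx.1 y hy.1⟩
  · rintro x ⟨hx, k, hk⟩ g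
    exact ⟨hBn.conj_mem x hx g, k, by rw [conj_pow, hk, mul_one, mul_inv_cancel]⟩
  · obtain ⟨x, hx⟩ := exists_prime_orderOf_dvd_card' (G := B) r hrB
    intro h
    have hxA : (x : Q) ∈ A := ⟨x.2, 1, by
      rw [pow_one, ← hx]; exact congrArg Subtype.val (pow_orderOf_eq_one x)⟩
    rw [h, Subgroup.mem_bot] at hxA
    have : x = 1 := Subtype.ext hxA
    rw [this, orderOf_one] at hx
    exact hr.one_lt.ne hx
  · rintro ⟨x, hx, k, hk⟩
    exact ⟨k, Subtype.ext hk⟩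

theorem NormIn.exists_chief {N G : Subgroup Γ} (hN : NormIn N G) (hG : Group.IsSolvable G)
    (hne : N ≠ G) : ∃ (M : Subgroup Γ) (r k : ℕ), r.Prime ∧ k ≠ 0 ∧ N ≤ M ∧ NormIn M G ∧
      N.relIndex M = r ^ k ∧ ∀ x ∈ M, ∀ y ∈ M, x * y * x⁻¹ * y⁻¹ ∈ N := by
  have := hN.normal
  let Q := G ⧸ N.subgroupOf G
  let π : G →* Q := QuotientGroup.mk' (N.subgroupOf G)
  have hπ : ∀ x, π x = 1 ↔ (x : Γ) ∈ N := fun x => QuotientGroup.eq_one_iff x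
  have hnt : Nontrivial Q := by
    rw [QuotientGroup.nontrivial_iff]
    intro h
    rw [Subgroup.subgroupOf_eq_top] at h
    exact hne (le_antisymm hN.le h)
  obtain ⟨r, A, hr, hA, hA0, hAp, hAc⟩ := exists_normal_isPGroup Q
  have : Fact r.Prime := ⟨hr⟩
  obtain ⟨k, hk⟩ := IsPGroup.iff_card.mp hAp
  let M := (A.comap π).map G.subtype
  have hM : ∀ x (hx : x ∈ G), x ∈ M ↔ π ⟨x, hx⟩ ∈ A := fun x hx => by
    constructor
    · rintro ⟨y, hy, rfl⟩
      exact hy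
    · intro h
      exact ⟨⟨x, hx⟩, h, rfl⟩
  have hMG : M ≤ G := Subgroup.map_subtype_le _
  have hNM : N ≤ M := fun x hx => by
    rw [hM x (hN.le hx), (hπ _).mpr hx]
    exact A.one_mem
  refine ⟨M, r, k, hr, ?_, hNM, ⟨hMG, ?_⟩, ?_, ?_⟩
  · rintro rfl
    rw [pow_zero] at hk
    exact hA0 (Subgroup.card_eq_one.mp hk)
  · intro g hg x
    by_cases hx : x ∈ G
    · rw [hM x hx, hM _ (G.mul_mem (G.mul_mem hg hx) (G.inv_mem hg))]
      have : π ⟨g * x * g⁻¹, G.mul_mem (G.mul_mem hg hx) (G.inv_mem hg)⟩ =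
        π ⟨g, hg⟩ * π ⟨x, hx⟩ * (π ⟨g, hg⟩)⁻¹ := by rw [← map_mul, ← map_inv, ← map_mul]; rfl
      rw [this]
      exact (hA.mem_comm_iff.trans (by rw [inv_mul_cancel_left]))
    · refine iff_of_false (fun h => hx ?_) fun h => hx (hMG h)
      have := hMG h
      rwa [Subgroup.mul_mem_cancel_right _ (G.inv_mem hg),
        Subgroup.mul_mem_cancel_left _ hg] at this
  · rw [← Subgroup.relIndex_subgroupOf hMG, ← hk, ← Subgroup.relIndex_bot_left]
    have h1 : M.subgroupOf G = A.comap π := Subgroup.ext fun x => hM x x.2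
    have h2 : N.subgroupOf G = (⊥ : Subgroup Q).comap π := Subgroup.ext fun x => (hπ x).symm
    refine (congrArg₂ Subgroup.relIndex h2 h1).trans ?_
    rw [Subgroup.relIndex_comap, Subgroup.map_comap_eq_self_of_surjective
      (QuotientGroup.mk'_surjective _)]
  · intro x hx y hy
    have hxG := hMG hx
    have hyG := hMG hy
    have := hAc _ ((hM x hxG).mp hx) _ ((hM y hyG).mp hy)
    rw [← mul_inv_eq_one, mul_inv_rev, ← mul_assoc, ← map_inv, ← map_inv, ← map_mul, ← map_mul,
      ← map_mul, hπ] at this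
    exact this

theorem exists_conj_mem_of_not_dvd_relIndex {p : ℕ} [Fact p.Prime] {R H : Subgroup Γ}
    (hi : ¬ p ∣ R.relIndex H) {x : Γ} (hx : x ∈ H) {k : ℕ} (hk : x ^ p ^ k = 1) :
    ∃ g ∈ H, g * x * g⁻¹ ∈ R := by
  have hz : IsPGroup p (Subgroup.zpowers (⟨x, hx⟩ : H)) := by
    refine IsPGroup.of_card_dvd_pow (n := k) ?_
    rw [Nat.card_zpowers]
    exact orderOf_dvd_of_pow_eq_one (Subtype.ext hk)
  obtain ⟨q, hq⟩ := hz.nonempty_fixed_point_of_prime_not_dvd_card (H ⧸ R.subgroupOf H) hi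
  obtain ⟨g, rfl⟩ := QuotientGroup.mk_surjective q
  have h1 : (((⟨x, hx⟩ : H) * g : H) : H ⧸ R.subgroupOf H) = (g : H ⧸ R.subgroupOf H) :=
    hq ⟨_, Subgroup.mem_zpowers _⟩
  rw [eq_comm, QuotientGroup.eq] at h1
  refine ⟨(g⁻¹ : H), (g⁻¹).2, ?_⟩
  simpa [Subgroup.mem_subgroupOf, mul_assoc] using h1

theorem NormIn.exists_sup {M R G : Subgroup Γ} (hM : NormIn M G) (hR : R ≤ G) :
    ∃ K, M ≤ K ∧ R ≤ K ∧ K ≤ G ∧ M.relIndex K = M.relIndex R := by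
  have := hM.normal
  refine ⟨(R.subgroupOf G ⊔ M.subgroupOf G).map G.subtype, ?_, ?_, Subgroup.map_subtype_le _, ?_⟩
  · intro x hx
    exact ⟨⟨x, hM.le hx⟩, (le_sup_right : M.subgroupOf G ≤ _) hx, rfl⟩
  · intro x hx
    exact ⟨⟨x, hR hx⟩, (le_sup_left : R.subgroupOf G ≤ _) hx, rfl⟩
  · have h1 := Subgroup.comap_map_eq_self_of_injective G.subtype_injective
      (R.subgroupOf G ⊔ M.subgroupOf G)
    rw [← Subgroup.relIndex_subgroupOf (Subgroup.map_subtype_le _)]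
    change (M.subgroupOf G).relIndex (Subgroup.comap G.subtype _) = _
    rw [h1, Subgroup.relIndex_sup_right, Subgroup.relIndex_subgroupOf hR]

/-- The restriction of a function to the `p`-elements of the subgroup `G`, extended by zero. -/
def pres (p : ℕ) (G : Subgroup Γ) : (Γ → ℂ) →ₗ[ℂ] (Γ → ℂ) where
  toFun f x := if x ∈ G ∧ ∃ k, x ^ p ^ k = 1 then f x else 0
  map_add' f g := by funext x; simp only [Pi.add_apply]; split_ifs <;> simp
  map_smul' c f := by funext x; simp only [Pi.smul_apply, RingHom.id_apply]; split_ifs <;> simp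

theorem pres_apply (p : ℕ) (G : Subgroup Γ) (f : Γ → ℂ) (x : Γ) :
    pres p G f x = if x ∈ G ∧ ∃ k, x ^ p ^ k = 1 then f x else 0 := rfl

theorem pres_congr {p : ℕ} {G : Subgroup Γ} {f g : Γ → ℂ}
    (h : ∀ x ∈ G, ∀ k, x ^ p ^ k = 1 → f x = g x) : pres p G f = pres p G g := by
  funext x
  rw [pres_apply, pres_apply]
  split_ifs with hx
  · obtain ⟨hx, k, hk⟩ := hx
    exact h x hx k hk
  · rfl

/-- The irreducible characters of `G` over `θ`. -/
def irrOver (G N : Subgroup Γ) (θ : Γ → ℂ) : Set (Γ → ℂ) := {χ | Irr G χ ∧ ip N χ θ ≠ 0}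

/-- The irreducible characters of `G` over `θ` without Galois conjugates over the `p`-cyclotomic
field. -/
def galIrrOver (p : ℕ) (G N : Subgroup Γ) (θ : Γ → ℂ) : Set (Γ → ℂ) :=
  {χ | χ ∈ irrOver G N θ ∧ ∀ σ, FixesRoots p σ → ∀ x ∈ G, σ (χ x) = χ x}

/-- Induction as a linear map. -/
def indLin (H G : Subgroup Γ) : (Γ → ℂ) →ₗ[ℂ] (Γ → ℂ) where
  toFun := indChar H G
  map_add' f g := by
    funext x
    simp only [indChar, Pi.add_apply, ← mul_add, ← Finset.sum_add_distrib]
    congr 1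
    exact Finset.sum_congr rfl fun g _ => by split_ifs <;> simp
  map_smul' c f := by
    funext x
    simp only [indChar, Pi.smul_apply, RingHom.id_apply, smul_eq_mul, mul_left_comm c,
      Finset.mul_sum]
    congr 1
    funext g
    split_ifs <;> simp

theorem pres_indLin_pres (p : ℕ) (H G : Subgroup Γ) (f : Γ → ℂ) :
    pres p G (indLin H G (pres p H f)) = pres p G (indChar H G f) := by
  refine pres_congr fun x _ k hk => ?_
  change indChar H G (pres p H f) x = _
  unfold indChar
  congr 1
  refine Finset.sum_congr rfl fun g _ => ?_
  split_ifs with h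
  · rw [pres_apply, if_pos ⟨h.2, k, by rw [conj_pow, hk, mul_one, mul_inv_cancel]⟩]
  · rfl

theorem map_indChar (H G : Subgroup Γ) (f : Γ → ℂ) (σ : ℂ →+* ℂ) (hf : ∀ x ∈ H, σ (f x) = f x)
    (x : Γ) : σ (indChar H G f x) = indChar H G f x := by
  simp only [indChar, map_mul, map_inv₀, map_natCast, map_sum]
  congr 1
  refine Finset.sum_congr rfl fun g _ => ?_
  split_ifs with h
  · exact hf _ h.2
  · exact map_zero σ

theorem irrOver_trans {G M N : Subgroup Γ} (hNM : N ≤ M) (hMG : M ≤ G) {θ ψ χ : Γ → ℂ}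
    (hθ : IsChar N θ) (hψ : Irr M ψ) (h : ip N ψ θ ≠ 0) (hχ : χ ∈ irrOver G M ψ) :
    χ ∈ irrOver G N θ :=
  ⟨hχ.1, ip_ne_zero_of_constituent hNM (hχ.1.isChar.restrict hMG) hψ hχ.2 hθ h⟩

theorem galIrrOver_trans {p : ℕ} {G M N : Subgroup Γ} (hNM : N ≤ M) (hMG : M ≤ G) {θ ψ : Γ → ℂ}
    (hθ : IsChar N θ) (hψ : Irr M ψ) (h : ip N ψ θ ≠ 0) :
    galIrrOver p G M ψ ⊆ galIrrOver p G N θ :=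
  fun _ hχ => ⟨irrOver_trans hNM hMG hθ hψ h hχ.1, hχ.2⟩

theorem IsChar.pres_mem_span {p : ℕ} {G M : Subgroup Γ} (hMG : M ≤ G) {φ θ : Γ → ℂ}
    (hφ : IsChar G φ) (hθ : Irr M θ) {e : ℂ} (h : ∀ x ∈ M, φ x = e * θ x) :
    pres p G φ ∈ Submodule.span ℂ (pres p G '' irrOver G M θ) := by
  obtain ⟨ι, _, f, h1, h2, h3⟩ := hφ.exists_decomp_ip
  have h4 : pres p G φ = ∑ i, pres p G (f i) := by
    rw [← map_sum]
    refine pres_congr fun x hx _ _ => ?_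
    rw [h3 x hx, Finset.sum_apply]
  rw [h4]
  refine Submodule.sum_mem _ fun i _ => Submodule.subset_span ⟨f i, ⟨h1 i, ?_⟩, rfl⟩
  obtain ⟨τ, hτ, h5⟩ := ((h1 i).isChar.restrict hMG).exists_irr (h1 i).one_ne_zero
  have h6 := ip_ne_zero_of_constituent hMG hφ (h1 i) (h2 i) hτ.isChar h5
  rw [ip_congr (f' := e • θ) h fun _ _ => rfl, ip_smul_left] at h6
  have h7 := hθ.eq_of_ip_ne_zero hτ (right_ne_zero_of_mul h6)
  rwa [ip_congr (fun _ _ => rfl) h7]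

theorem IsChar.pow {H : Subgroup Γ} {f : Γ → ℂ} (hf : IsChar H f) (k : ℕ) :
    IsChar H fun x => f x ^ k := by
  induction k with
  | zero => simpa using isChar_one H
  | succ k ih => simpa only [pow_succ] using ih.mul hf

theorem mem_of_pow_mem_of_coprime {N : Subgroup Γ} {x : Γ} {m n : ℕ} (h : m.Coprime n)
    (h1 : x ^ m ∈ N) (h2 : x ^ n ∈ N) : x ∈ N := by
  have h3 := Nat.gcd_eq_gcd_ab m n
  rw [h, Nat.cast_one] at h3
  have h4 : x = (x ^ m) ^ m.gcdA n * (x ^ n) ^ m.gcdB n := by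
    rw [← zpow_natCast, ← zpow_natCast, ← zpow_mul, ← zpow_mul, ← zpow_add, ← h3, zpow_one]
  rw [h4]
  exact N.mul_mem (N.zpow_mem h1 _) (N.zpow_mem h2 _)

/-- A character of a subgroup of index prime to `p` agreeing with `χ` on `p`-elements
can be induced, and the result divided by the permutation character without leaving the span of
the characters over `θ`. -/
theorem pres_mem_span_of_subgroup {p : ℕ} [Fact p.Prime] {G M K : Subgroup Γ} (hMG : NormIn M G)
    (hMK : M ≤ K) (hKG : K ≤ G) (hi : ¬ p ∣ K.relIndex G) {θ χ β : Γ → ℂ} (hθ : Irr M θ)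
    (hinv : InvOn G M θ) (hχ : IsClassFun G χ) (hβ : IsChar K β)
    (hβχ : ∀ x ∈ K, ∀ k, x ^ p ^ k = 1 → β x = χ x) {e : ℂ} (he : ∀ x ∈ M, β x = e * θ x) :
    pres p G χ ∈ Submodule.span ℂ (pres p G '' irrOver G M θ) := by
  set c := indChar K G fun _ => 1 with hc
  set Φ := indChar K G β with hΦ
  have hcc : IsChar G c := (isChar_one K).indChar hKG
  have hΦc : IsChar G Φ := hβ.indChar hKG
  have h1 : ∀ k, pres p G (fun x => Φ x * c x ^ k) ∈
      Submodule.span ℂ (pres p G '' irrOver G M θ) := by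
    intro k
    refine IsChar.pres_mem_span hMG.le (hΦc.mul (hcc.pow k)) hθ
      (e := (Nat.card K : ℂ)⁻¹ * (∑ g : Γ, if g ∈ G then e else 0) *
        ((Nat.card K : ℂ)⁻¹ * ∑ g : Γ, if g ∈ G then 1 else 0) ^ k) fun x hx => ?_
    rw [hΦ, hc, indChar_apply_normal hMG hMK _ hx, indChar_apply_normal hMG hMK _ hx]
    have : (∑ g : Γ, if g ∈ G then β (g * x * g⁻¹) else 0) =
        (∑ g : Γ, if g ∈ G then e else 0) * θ x := by
      rw [Finset.sum_mul]
      refine Finset.sum_congr rfl fun g _ => ?_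
      split_ifs with hg
      · rw [he _ ((hMG.conj_mem_iff g hg x).mpr hx), hinv g hg x hx]
      · rw [zero_mul]
    rw [this]
    ring
  have h2 : ∀ x ∈ G, ∀ k, x ^ p ^ k = 1 → Φ x = χ x * c x := by
    intro x hx k hk
    rw [hΦ, hc, indChar, indChar, mul_left_comm, Finset.mul_sum _ _ (χ x)]
    congr 1
    refine Finset.sum_congr rfl fun g _ => ?_
    split_ifs with h
    · rw [mul_one, hβχ _ h.2 k (by rw [conj_pow, hk, mul_one, mul_inv_cancel]), hχ g h.1 x hx]
    · rw [mul_zero]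
  have h3 : ∀ x ∈ G, ∀ k, x ^ p ^ k = 1 → c x ≠ 0 := by
    intro x hx k hk
    obtain ⟨g, hg, hgx⟩ := exists_conj_mem_of_not_dvd_relIndex hi hx hk
    rw [hc, indChar, ← Finset.sum_filter, Finset.sum_const, nsmul_eq_mul, mul_one]
    exact mul_ne_zero (inv_ne_zero (card_ne_zero' K))
      (Nat.cast_ne_zero.mpr (Finset.card_ne_zero.mpr ⟨g, by simp [hg, hgx]⟩))
  obtain ⟨q, hq⟩ : ∃ q : Polynomial ℂ, ∀ x, q.eval (c x) = (c x)⁻¹ :=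
    ⟨Lagrange.interpolate (Finset.univ.image c) id fun z => z⁻¹, fun x =>
      Lagrange.eval_interpolate_at_node (v := id) (i := c x) _ Function.injective_id.injOn
        (Finset.mem_image_of_mem c (Finset.mem_univ x))⟩
  have h4 : pres p G χ = ∑ k ∈ Finset.range (q.natDegree + 1),
      q.coeff k • pres p G (fun x => Φ x * c x ^ k) := by
    simp_rw [← map_smul]
    rw [← map_sum]
    refine pres_congr fun x hx k hk => ?_
    have h5 : χ x = Φ x * q.eval (c x) := by
      rw [hq, h2 x hx k hk, mul_inv_cancel_right₀ (h3 x hx k hk)]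
    rw [h5, Polynomial.eval_eq_sum_range, Finset.mul_sum, Finset.sum_apply]
    exact Finset.sum_congr rfl fun k _ => by simp only [Pi.smul_apply, smul_eq_mul]; ring
  rw [h4]
  exact Submodule.sum_mem _ fun k _ => Submodule.smul_mem _ _ (h1 k)

theorem Special.pres_mem_span_extension {p : ℕ} [hp : Fact p.Prime] {N M G : Subgroup Γ}
    {θ θ' χ : Γ → ℂ}
    (h : Special p N θ) (h' : Special p M θ') (hNM : N ≤ M) (hNG : NormIn N G) (hMG : NormIn M G)
    (hm : ¬ p ∣ N.relIndex M) (heq : ∀ x ∈ N, θ' x = θ x) (hinv : InvOn G M θ')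
    (hχ : Irr G χ) (hχθ : ip N χ θ ≠ 0) :
    pres p G χ ∈ Submodule.span ℂ (pres p G '' irrOver G M θ') := by
  have hinvN : InvOn G N θ := fun g hg x hx => by
    rw [← heq x hx, ← heq _ ((hNG.conj_mem_iff g hg x).mpr hx), hinv g hg x (hNM hx)]
  obtain ⟨P, hPG, hP, hPi⟩ := exists_sylow_le p G
  obtain ⟨R, hNR, hPR, hRG, hR⟩ := hNG.exists_sup hPG
  obtain ⟨K, hMK, hRK, hKG, hK⟩ := hMG.exists_sup hRG
  obtain ⟨b, hb⟩ : ∃ b, N.relIndex R = p ^ b := by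
    obtain ⟨n, hn⟩ := IsPGroup.iff_card.mp hP
    obtain ⟨b, -, hb⟩ := (Nat.dvd_prime_pow hp.out).mp (hn ▸ Subgroup.relIndex_dvd_card N P)
    exact ⟨b, hR.trans hb⟩
  have hRi : ¬ p ∣ R.relIndex G := fun hd => hPi
    (Subgroup.relIndex_mul_relIndex P R G hPR hRG ▸ hd.mul_left _)
  have hmul := Subgroup.relIndex_mul_relIndex R K G hRK hKG
  have hKi : ¬ p ∣ K.relIndex G := fun hd => hRi (hmul ▸ hd.mul_left _)
  have hRKi : ¬ p ∣ R.relIndex K := fun hd => hRi (hmul ▸ hd.mul_right _)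
  have hinf : M ⊓ R = N := by
    refine le_antisymm (fun x hx => ?_) (le_inf hNM hNR)
    refine mem_of_pow_mem_of_coprime (((Nat.Prime.coprime_iff_not_dvd hp.out).mpr hm).pow_left b)
      (hb ▸ (hNG.of_le hNR hRG).pow_relIndex_mem hx.2)
      ((hNG.of_le hNM hMG.le).pow_relIndex_mem hx.1)
  have hMKn := hMG.of_le hMK hKG
  have hinvK : InvOn K M θ' := fun g hg => hinv g (hKG hg)
  have S : Supplement M K R θ' := by
    refine ⟨hMKn, hRK, ?_, h'.irr, hinvK, hinf ▸ h.irr.congr heq⟩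
    rw [← card_mul_relIndex hMK, ← card_mul_relIndex (inf_le_right : M ⊓ R ≤ R),
      Subgroup.inf_relIndex_right, hK]
    ring
  obtain ⟨ι, _, α, h1, h2, h3⟩ := (hχ.isChar.restrict hRG).exists_decomp_ip
  have h4 : ∀ i, ∃ ψ, Irr K ψ ∧ ip M ψ θ' ≠ 0 ∧ ∀ x ∈ R, ψ x = α i x := by
    intro i
    refine S.exists_extension (h1 i) ?_
    rw [hinf, ip_congr (fun _ _ => rfl) heq]
    obtain ⟨τ, hτ, h5⟩ := ((h1 i).isChar.restrict hNR).exists_irr (h1 i).one_ne_zero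
    have h6 := ip_ne_zero_of_constituent hNR (hχ.isChar.restrict hRG) (h1 i) (h2 i) hτ.isChar h5
    obtain ⟨g, hg, h7⟩ := hχ.exists_conj hNG h.irr hτ hχθ h6
    rwa [ip_congr (g' := τ) (fun _ _ => rfl) fun x hx => by rw [← h7 x hx, hinvN g hg x hx]]
  choose ψ h5 h6 h7 using h4
  choose e _ he using fun i => (h5 i).eq_nat_mul hMKn h'.irr hinvK (h6 i)
  have hβ : IsChar K fun x => ∑ i, ψ i x := IsChar.sum Finset.univ fun i _ => (h5 i).isChar
  refine pres_mem_span_of_subgroup hMG hMK hKG hKi h'.irr hinv hχ.isChar.isClassFun hβ ?_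
    (e := ∑ i, (e i : ℂ)) fun x hx => ?_
  · intro x hx k hk
    obtain ⟨g, hg, hgx⟩ := exists_conj_mem_of_not_dvd_relIndex hRKi hx hk
    rw [← hχ.isChar.conj (hKG hg) (hKG hx), h3 _ hgx, ← hβ.conj hg hx]
    exact Finset.sum_congr rfl fun i _ => h7 i _ hgx
  · rw [Finset.sum_mul]
    exact Finset.sum_congr rfl fun i _ => he i x hx

theorem Special.pres_mem_span {p : ℕ} [hp : Fact p.Prime] {N G : Subgroup Γ} {θ χ : Γ → ℂ}
    (h : Special p N θ) (hNG : NormIn N G) (hG : Group.IsSolvable G) (hχ : Irr G χ)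
    (hχθ : ip N χ θ ≠ 0) :
    pres p G χ ∈ Submodule.span ℂ (pres p G '' galIrrOver p G N θ) := by
  induction hn : N.relIndex G using Nat.strong_induction_on generalizing N G θ χ with
  | _ n ih =>
  subst hn
  have hpos : ∀ H K : Subgroup Γ, 0 < H.relIndex K := fun H K =>
    Nat.pos_of_ne_zero Subgroup.index_ne_zero_of_finite
  have hlt : ∀ {H K L : Subgroup Γ}, H ≤ K → K ≤ L → H ≠ K → K.relIndex L < H.relIndex L := by
    intro H K L h1 h2 h3
    rw [← Subgroup.relIndex_mul_relIndex H K L h1 h2]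
    refine lt_mul_of_one_lt_left (hpos K L) (lt_of_le_of_ne (hpos H K) fun h4 => ?_)
    exact h3 (le_antisymm h1 (Subgroup.relIndex_eq_one.mp h4.symm))
  by_cases hinv : InvOn G N θ
  · by_cases hne : N = G
    · subst hne
      refine Submodule.subset_span ⟨χ, ⟨⟨hχ, hχθ⟩, fun σ hσ x hx => ?_⟩, rfl⟩
      rw [hχ.eq_of_ip_ne_zero h.irr hχθ x hx, h.gal σ hσ x hx]
    obtain ⟨M, r, k, hr, hk, hNM, hMG, hidx, hab⟩ := hNG.exists_chief hG hne
    have hNM' : N ≠ M := by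
      rintro rfl
      rw [Subgroup.relIndex_self] at hidx
      exact (Nat.one_lt_pow hk hr.one_lt).ne hidx
    have hNMn := hNG.of_le hNM hMG.le
    have hlt' := hlt hNM hMG.le hNM'
    by_cases hrp : r = p
    · subst hrp
      obtain ⟨ψ, hψ, h1, h2⟩ := (hχ.isChar.restrict hMG.le).exists_irr_ip_ne_zero hNM hχθ
      have hψs := h.of_relIndex_eq_pow hNMn hidx (fun g hg => hinv g (hMG.le hg)) hψ h2
      exact Submodule.span_mono (Set.image_mono (galIrrOver_trans hNM hMG.le h.irr.isChar hψ h2))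
        (ih _ hlt' hψs hMG hG hχ h1 rfl)
    · have hm : ¬ p ∣ N.relIndex M := fun hd =>
        hrp ((Nat.prime_dvd_prime_iff_eq hp.out hr).mp (hp.out.dvd_of_dvd_pow (hidx ▸ hd))).symm
      obtain ⟨θ', hθ', heq, hinv'⟩ := h.exists_extension hNMn hm hab hNG hMG hinv
      have hθθ' : ip N θ' θ ≠ 0 := by
        rw [ip_congr heq fun _ _ => rfl, h.irr.ip_self]
        exact one_ne_zero
      refine Submodule.span_le.mpr ?_
        (h.pres_mem_span_extension hθ' hNM hNG hMG hm heq hinv' hχ hχθ)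
      rintro _ ⟨φ, hφ, rfl⟩
      exact Submodule.span_mono
        (Set.image_mono (galIrrOver_trans hNM hMG.le h.irr.isChar hθ'.irr hθθ'))
        (ih _ hlt' hθ' hMG hG hφ.1 hφ.2 rfl)
  · let T : Subgroup Γ :=
      { carrier := {g | g ∈ G ∧ ∀ x ∈ N, θ (g * x * g⁻¹) = θ x}
        one_mem' := ⟨G.one_mem, fun x _ => by simp⟩
        mul_mem' := by
          rintro a b ⟨ha, ha'⟩ ⟨hb, hb'⟩
          refine ⟨G.mul_mem ha hb, fun x hx => ?_⟩
          rw [← hb' x hx, ← ha' _ ((hNG.conj_mem_iff b hb x).mpr hx)]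
          congr 1
          group
        inv_mem' := by
          rintro a ⟨ha, ha'⟩
          refine ⟨G.inv_mem ha, fun x hx => ?_⟩
          rw [← ha' _ ((hNG.conj_mem_iff _ (G.inv_mem ha) x).mpr hx)]
          congr 1
          group }
    have hTG : T ≤ G := fun _ hg => hg.1
    have hNT : N ≤ T := fun g hg => ⟨hNG.le hg, fun x hx => h.irr.isChar.conj hg hx⟩
    have hT : ∀ g ∈ G, g ∈ T ↔ ∀ x ∈ N, θ (g * x * g⁻¹) = θ x := fun g hg =>
      ⟨fun h => h.2, fun h => ⟨hg, h⟩⟩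
    have hTG' : T ≠ G := fun h => hinv fun g hg => (hT g hg).mp (h ▸ hg)
    have hlt' : N.relIndex T < N.relIndex G := by
      rw [← Subgroup.relIndex_mul_relIndex N T G hNT hTG]
      refine lt_mul_of_one_lt_right (hpos N T) (lt_of_le_of_ne (hpos T G) fun h4 => ?_)
      exact hTG' (le_antisymm hTG (Subgroup.relIndex_eq_one.mp h4.symm))
    obtain ⟨η, hη, hηθ, h1⟩ := Irr.eq_indChar_stabilizer hNG hNT hTG h.irr hT hχ hχθ
    have hsol : Group.IsSolvable T :=
      Group.isSolvable_of_isSolvable_injective (Subgroup.inclusion_injective hTG)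
    have h2 := ih _ hlt' h (hNG.of_le hNT hTG) hsol hη hηθ rfl
    have h3 : pres p G χ = (pres p G ∘ₗ indLin T G) (pres p T η) := by
      rw [LinearMap.comp_apply, pres_indLin_pres]
      exact pres_congr fun x hx _ _ => h1 x hx
    rw [h3]
    refine (Submodule.span_le (p := (Submodule.span ℂ _).comap (pres p G ∘ₗ indLin T G))).mpr ?_ h2
    rintro _ ⟨φ, ⟨⟨hφ, hφθ⟩, hφσ⟩, rfl⟩
    refine Submodule.subset_span ⟨indChar T G φ,
      ⟨⟨Irr.indChar_stabilizer hNG hNT hTG h.irr hT hφ hφθ,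
      ip_indChar_ne_zero hTG hNT h.irr hφ hφθ⟩,
      fun σ hσ x _ => map_indChar T G φ σ (hφσ σ hσ) x⟩, ?_⟩
    rw [LinearMap.comp_apply, pres_indLin_pres]

theorem exists_ringHom_extending {L Ω : Type*} [Field L] [Field Ω] [Algebra L Ω] [IsAlgClosed Ω]
    (τ : L ≃+* L) : ∃ σ : Ω →+* Ω, ∀ x : L, σ (algebraMap L Ω x) = algebraMap L Ω (τ x) := by
  obtain ⟨s, hs⟩ := exists_isTranscendenceBasis L Ω
  have hc := IsAlgClosed.isAlgClosure_of_transcendence_basis _ hs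
  let e := (hs.1.aevalEquiv.symm.toRingEquiv.trans (MvPolynomial.mapEquiv _ τ)).trans
    hs.1.aevalEquiv.toRingEquiv
  refine ⟨(IsAlgClosure.equivOfEquiv Ω Ω e : Ω ≃+* Ω), fun x => ?_⟩
  have h1 := IsAlgClosure.equivOfEquiv_algebraMap Ω Ω e
    (algebraMap L (Algebra.adjoin L (Set.range ((↑) : s → Ω))) x)
  have h2 : e (algebraMap L _ x) = algebraMap L _ (τ x) := by
    have h3 := hs.1.aevalEquiv.commutes (τ x)
    rw [MvPolynomial.algebraMap_eq] at h3
    simpa [e, MvPolynomial.mapEquiv_apply, MvPolynomial.algebraMap_eq] using h3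
  rw [h2] at h1
  exact h1

theorem mem_of_forall_ringHom {Ω : Type*} [Field Ω] [IsAlgClosed Ω] [CharZero Ω] (K : Subfield Ω)
    {z : Ω} (hz : IsIntegral K z) (h : ∀ σ : Ω →+* Ω, (∀ x ∈ K, σ x = x) → σ z = z) : z ∈ K := by
  let L := algebraicClosure K Ω
  have : IsGalois K L := {}
  let w : L := ⟨z, mem_algebraicClosure_iff'.mpr hz⟩
  have h1 := (InfiniteGalois.mem_range_algebraMap_iff_fixed (k := K) w).mpr fun τ => by
    obtain ⟨σ, hσ⟩ := exists_ringHom_extending (Ω := Ω) (τ : L ≃+* L)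
    refine Subtype.ext ?_
    refine (hσ w).symm.trans (h σ fun x hx => ?_)
    have := hσ (algebraMap K L ⟨x, hx⟩)
    rw [AlgEquiv.coe_ringEquiv, τ.commutes] at this
    exact this
  obtain ⟨k, hk⟩ := h1
  have : (k : Ω) = z := congrArg Subtype.val hk
  exact this ▸ k.2

theorem mem_Qfield_of_forall {p : ℕ} {z : ℂ} (hz : IsIntegral ℤ z)
    (h : ∀ σ, FixesRoots p σ → σ z = z) : z ∈ Qfield p :=
  mem_of_forall_ringHom _ hz.tower_top fun σ hσ => h σ fun k x hx =>
    hσ x (Subfield.subset_closure ⟨k + 1, k.succ_pos, by rw [pow_succ, pow_mul, hx, one_pow]⟩)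

theorem IsChar.mul_eq {H M : Subgroup Γ} (hMH : M ≤ H) {f : Γ → ℂ} (hf : IsChar H f)
    (h : ∀ m ∈ M, f m = f 1) {x m : Γ} (hx : x ∈ H) (hm : m ∈ M) : f (x * m) = f x := by
  obtain ⟨V, _, _, _, ρ, hf⟩ := hf
  have : Invertible (Nat.card M : ℂ) := invertibleOfNonzero (card_ne_zero' M)
  let τ : Representation ℂ M V := ρ.comp (Subgroup.inclusion hMH)
  have h1 : Module.finrank ℂ (invariants τ) = Module.finrank ℂ V := by
    have h2 := card_inv_mul_sum_char_eq_finrank τ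
    have h3 : ∀ m : M, τ.character m = Module.finrank ℂ V := fun m => by
      change ρ.character (Subgroup.inclusion hMH m) = _
      rw [← hf, ← ρ.char_one, ← hf]
      exact h m m.2
    simp only [h3, Finset.sum_const, Finset.card_univ, nsmul_eq_mul] at h2
    rw [← Nat.card_eq_fintype_card, inv_mul_cancel_left₀ (card_ne_zero' M)] at h2
    exact_mod_cast h2.symm
  have h4 : invariants τ = ⊤ := Submodule.eq_top_of_finrank_eq h1
  have h5 : ρ ⟨m, hMH hm⟩ = 1 := LinearMap.ext fun v =>
    (h4.symm ▸ Submodule.mem_top : v ∈ invariants τ) ⟨m, hm⟩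
  have h6 := hf (⟨x, hx⟩ * ⟨m, hMH hm⟩)
  rw [Representation.character, map_mul, h5, mul_one] at h6
  exact h6.trans (hf ⟨x, hx⟩).symm

theorem ip_top (f g : Γ → ℂ) : ip ⊤ f g = (Nat.card Γ : ℂ)⁻¹ * ∑ x, f x * g x⁻¹ := by
  simp [ip_eq_ite]

theorem isIrreducibleCharacter_iff {χ : Γ → ℂ} : IsIrreducibleCharacter Γ χ ↔ Irr ⊤ χ := by
  have hc : (Nat.card Γ : ℂ) ≠ 0 := Nat.cast_ne_zero.mpr Nat.card_pos.ne'
  constructor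
  · rintro ⟨V, hV, rfl⟩
    refine Irr.of_ip_self ⟨V, inferInstance, inferInstance, inferInstance,
      MonoidHom.comp V.ρ (⊤ : Subgroup Γ).subtype, fun _ => rfl⟩ ?_
    rw [ip_top, V.simple_iff_char_is_norm_one.mp hV, inv_mul_cancel₀ hc]
  · intro h
    have h1 := h.ip_self
    obtain ⟨V, _, _, _, ρ, hρ⟩ := h.isChar
    have h2 : χ = fun g => (FDRep.of (MonoidHom.comp ρ
      (Subgroup.topEquiv (G := Γ)).symm.toMonoidHom)).character g :=
      funext fun g => hρ ⟨g, Subgroup.mem_top g⟩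
    refine ⟨_, (FDRep.simple_iff_char_is_norm_one _).mpr ?_, h2⟩
    rw [ip_top, inv_mul_eq_iff_eq_mul₀ hc, mul_one] at h1
    rw [← h1]
    exact Finset.sum_congr rfl fun g _ => by rw [congrFun h2 g, congrFun h2 g⁻¹]

theorem finite_isIrreducibleCharacter (Γ : Type) [Group Γ] [Fintype Γ] :
    {χ : Γ → ℂ | IsIrreducibleCharacter Γ χ}.Finite :=
  (finite_irr ⊤).subset fun _ h =>
    ⟨isIrreducibleCharacter_iff.mp h, fun _ hx => absurd (Subgroup.mem_top _) hx⟩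

theorem IsIrreducibleCharacter.comp_mk {M : Subgroup Γ} [M.Normal] {f : Γ ⧸ M → ℂ}
    (hf : IsIrreducibleCharacter (Γ ⧸ M) f) :
    IsIrreducibleCharacter Γ fun x => f x := by
  have h1 := (isIrreducibleCharacter_iff.mp hf).ip_self
  obtain ⟨V, hV, rfl⟩ := hf
  refine isIrreducibleCharacter_iff.mpr (Irr.of_ip_self ⟨V, inferInstance, inferInstance,
    inferInstance, MonoidHom.comp V.ρ ((QuotientGroup.mk' M).comp (⊤ : Subgroup Γ).subtype),
    fun _ => rfl⟩ ?_)
  rw [ip_top] at h1 ⊢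
  have h2 : ∀ F : Γ ⧸ M → ℂ, ∑ x : Γ, F x = Nat.card M * ∑ y, F y := fun F => by
    rw [← Finset.sum_fiberwise (Finset.univ : Finset Γ) (fun x => (x : Γ ⧸ M)), Finset.mul_sum]
    refine Finset.sum_congr rfl fun y _ => ?_
    rw [Finset.sum_congr rfl (g := fun _ => F y) fun x hx => by rw [(Finset.mem_filter.mp hx).2],
      Finset.sum_const, nsmul_eq_mul]
    congr 2
    obtain ⟨z, rfl⟩ := QuotientGroup.mk_surjective y
    rw [← Fintype.card_subtype, ← Nat.card_eq_fintype_card]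
    exact Nat.card_congr ((Equiv.mulLeft z).subtypeEquiv fun a => by
      simp).symm
  have h3 := h2 fun y => V.character y * V.character y⁻¹
  simp only [QuotientGroup.mk_inv] at h3 ⊢
  rw [h3, Subgroup.card_eq_card_quotient_mul_card_subgroup M, Nat.cast_mul, mul_inv, mul_assoc,
    inv_mul_cancel_left₀ (card_ne_zero' M)]
  exact h1

/-- The conjugacy classes of elements of `r`-power order. -/
def rClasses (r : ℕ) (Γ : Type) [Group Γ] : Set (ConjClasses Γ) :=
  {c | ∃ g : Γ, c = ConjClasses.mk g ∧ ∃ k, g ^ r ^ k = 1}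

theorem pow_eq_one_of_isConj {g h : Γ} (e : IsConj g h) {n : ℕ} (hh : h ^ n = 1) : g ^ n = 1 := by
  obtain ⟨c, rfl⟩ := isConj_iff.mp e
  rw [conj_pow] at hh
  exact conj_eq_one_iff.mp hh

theorem mk_mem_rClasses {r : ℕ} {g : Γ} : ConjClasses.mk g ∈ rClasses r Γ ↔ ∃ k, g ^ r ^ k = 1 :=
  ⟨fun ⟨_, e, k, hk⟩ => ⟨k, pow_eq_one_of_isConj (ConjClasses.mk_eq_mk_iff_isConj.mp e) hk⟩,
    fun h => ⟨g, rfl, h⟩⟩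

theorem mk_mem_PrimePowerClasses {g : Γ} :
    ConjClasses.mk g ∈ PrimePowerClasses Γ ↔ ∃ p, p.Prime ∧ ∃ k, g ^ p ^ k = 1 := by
  constructor
  · rintro ⟨h, e, p, k, hp, hk⟩
    exact ⟨p, hp, k, pow_eq_one_of_isConj (ConjClasses.mk_eq_mk_iff_isConj.mp e)
      (hk ▸ pow_orderOf_eq_one h)⟩
  · rintro ⟨p, hp, k, hk⟩
    obtain ⟨j, -, hj⟩ := (Nat.dvd_prime_pow hp).mp (orderOf_dvd_of_pow_eq_one hk)
    exact ⟨g, rfl, p, j, hp, hj⟩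

theorem rClasses_subset {r : ℕ} (hr : r.Prime) : rClasses r Γ ⊆ PrimePowerClasses Γ := by
  rintro _ ⟨g, rfl, h⟩
  exact mk_mem_PrimePowerClasses.mpr ⟨r, hr, h⟩

theorem isConj_of_mk_eq {M : Subgroup Γ} [M.Normal] {q k l : ℕ} (hq : q.Prime)
    (hqM : ¬ q ∣ Nat.card M) {g h : Γ} (hg : g ^ q ^ k = 1) (hh : h ^ q ^ l = 1)
    (e : (g : Γ ⧸ M) = h) : IsConj g h := by
  have : Fact q.Prime := ⟨hq⟩
  let K : Subgroup Γ := (Subgroup.zpowers (h : Γ ⧸ M)).comap (QuotientGroup.mk' M)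
  have hZK : Subgroup.zpowers h ≤ K := by
    rw [Subgroup.zpowers_le]
    exact Subgroup.mem_zpowers (h : Γ ⧸ M)
  have hMK : M ≤ K := fun m hm => by
    change (m : Γ ⧸ M) ∈ Subgroup.zpowers (h : Γ ⧸ M)
    rw [(QuotientGroup.eq_one_iff m).mpr hm]
    exact one_mem _
  have h1 : M.relIndex K = orderOf (h : Γ ⧸ M) := by
    have h2 := Subgroup.relIndex_comap (⊥ : Subgroup (Γ ⧸ M)) (QuotientGroup.mk' M) K
    rw [MonoidHom.comap_bot, QuotientGroup.ker_mk',
      Subgroup.map_comap_eq_self_of_surjective (QuotientGroup.mk'_surjective M),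
      Subgroup.relIndex_bot_left, Nat.card_zpowers] at h2
    exact h2
  have h2 : ¬ q ∣ (Subgroup.zpowers h).relIndex K := by
    obtain ⟨c, hc⟩ := orderOf_map_dvd (QuotientGroup.mk' M) h
    have h3 := (card_mul_relIndex hZK).trans (card_mul_relIndex hMK).symm
    rw [h1, Nat.card_zpowers, hc, mul_assoc, mul_comm (Nat.card M)] at h3
    exact fun hd => hqM (Nat.eq_of_mul_eq_mul_left (orderOf_pos (h : Γ ⧸ M)) h3 ▸ hd.mul_left c)
  have hgK : g ∈ K := by
    change (g : Γ ⧸ M) ∈ Subgroup.zpowers (h : Γ ⧸ M)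
    rw [e]
    exact Subgroup.mem_zpowers _
  obtain ⟨u, ⟨j, hj⟩, z, hz⟩ := exists_conj_mem_of_not_dvd_relIndex h2 hgK hg
  refine isConj_iff.mpr ⟨u, ?_⟩
  rw [← mul_inv_eq_one, ← Subgroup.mem_bot]
  have hm : u * g * u⁻¹ * h⁻¹ ∈ M := by
    rw [← QuotientGroup.eq_one_iff]
    simp only [QuotientGroup.mk_mul, QuotientGroup.mk_inv, e]
    have hj' : (h : Γ ⧸ M) ^ j = (u : Γ ⧸ M) := hj
    rw [← hj', ← zpow_neg, ← zpow_add_one, ← zpow_add]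
    simp
  have hcop : (q ^ l).Coprime (Nat.card M) :=
    ((Nat.Prime.coprime_iff_not_dvd hq).mpr hqM).pow_left l
  refine mem_of_pow_mem_of_coprime hcop ?_ ?_
  · have hz' : h ^ z = u * g * u⁻¹ := hz
    rw [← hz', ← zpow_sub_one, ← zpow_natCast, ← zpow_mul, mul_comm, zpow_mul, zpow_natCast, hh,
      one_zpow]
    exact one_mem _
  · exact congrArg Subtype.val (pow_card_eq_one' (x := (⟨_, hm⟩ : M)))

theorem eq_one_of_pow_prime_pow {p q : ℕ} (hp : p.Prime) (hq : q.Prime) (hpq : p ≠ q) {x : Γ}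
    {k l : ℕ} (h1 : x ^ p ^ k = 1) (h2 : x ^ q ^ l = 1) : x = 1 :=
  Subgroup.mem_bot.mp (mem_of_pow_mem_of_coprime
    (Nat.Coprime.pow k l ((Nat.coprime_primes hp hq).mpr hpq))
    (Subgroup.mem_bot.mpr h1) (Subgroup.mem_bot.mpr h2))

theorem ncard_primePowerClasses_diff_le {M : Subgroup Γ} [M.Normal] {r : ℕ} (hr : r.Prime)
    (hM : IsPGroup r M) :
    (PrimePowerClasses Γ \ rClasses r Γ).ncard ≤
      (PrimePowerClasses (Γ ⧸ M) \ rClasses r (Γ ⧸ M)).ncard := by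
  have : Fact r.Prime := ⟨hr⟩
  have hker : ∀ g : Γ, (g : Γ ⧸ M) = 1 → ConjClasses.mk g ∈ rClasses r Γ := fun g hg =>
    mk_mem_rClasses.mpr (exists_pow_mem_of_isPGroup hM ((QuotientGroup.eq_one_iff g).mp hg))
  have hpow : ∀ {g : Γ} {n : ℕ}, g ^ n = 1 → (g : Γ ⧸ M) ^ n = 1 := fun h => by
    rw [← QuotientGroup.mk_pow, h, QuotientGroup.mk_one]
  refine Set.ncard_le_ncard_of_injOn (ConjClasses.map (QuotientGroup.mk' M)) ?_ ?_
    (Set.toFinite _)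
  · rintro c ⟨hc, hcr⟩
    obtain ⟨g, rfl⟩ := ConjClasses.mk_surjective c
    obtain ⟨q, hq, k, hk⟩ := mk_mem_PrimePowerClasses.mp hc
    refine ⟨mk_mem_PrimePowerClasses.mpr ⟨q, hq, k, hpow hk⟩, fun h => hcr ?_⟩
    obtain ⟨l, hl⟩ := mk_mem_rClasses.mp h
    by_cases hqr : q = r
    · exact mk_mem_rClasses.mpr ⟨k, hqr ▸ hk⟩
    · exact hker g (eq_one_of_pow_prime_pow hq hr hqr (hpow hk) hl)
  · rintro c ⟨hc, hcr⟩ d ⟨hd, hdr⟩ e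
    obtain ⟨g, rfl⟩ := ConjClasses.mk_surjective c
    obtain ⟨h, rfl⟩ := ConjClasses.mk_surjective d
    obtain ⟨q, hq, k, hk⟩ := mk_mem_PrimePowerClasses.mp hc
    obtain ⟨p, hp, l, hl⟩ := mk_mem_PrimePowerClasses.mp hd
    obtain ⟨y, hy⟩ := isConj_iff.mp (ConjClasses.mk_eq_mk_iff_isConj.mp e)
    obtain ⟨u, rfl⟩ := QuotientGroup.mk_surjective y
    have hgu : IsConj g (u * g * u⁻¹) := isConj_iff.mpr ⟨u, rfl⟩
    have hk' : (u * g * u⁻¹) ^ q ^ k = 1 := pow_eq_one_of_isConj hgu.symm hk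
    have e' : ((u * g * u⁻¹ : Γ) : Γ ⧸ M) = h := hy
    have hqp : p = q := by
      by_contra hpq
      exact hdr (hker h (eq_one_of_pow_prime_pow hp hq hpq (hpow hl) (e' ▸ hpow hk')))
    subst hqp
    refine ConjClasses.mk_eq_mk_iff_isConj.mpr (hgu.trans (isConj_of_mk_eq hp ?_ hk' hl e'))
    intro hd
    obtain ⟨b, hb⟩ := IsPGroup.iff_card.mp hM
    rw [hb] at hd
    obtain rfl := (Nat.prime_dvd_prime_iff_eq hp hr).mp (hp.dvd_of_dvd_pow hd)
    exact hdr (mk_mem_rClasses.mpr ⟨l, hl⟩)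

/-- The irreducible characters with values in the `r`-cyclotomic field whose kernel does not
contain `M`. -/
def irrNotOver (r : ℕ) (M : Subgroup Γ) : Set (Γ → ℂ) :=
  {χ | IsIrreducibleCharacter Γ χ ∧ (∀ g, χ g ∈ Qfield r) ∧ ∃ m ∈ M, χ m ≠ χ 1}

theorem special_of_isPGroup {r : ℕ} [Fact r.Prime] {M : Subgroup Γ} (hM : IsPGroup r M)
    {ψ : Γ → ℂ} (hψ : Irr M ψ) : Special r M ψ := by
  obtain ⟨b, hb⟩ := IsPGroup.iff_card.mp hM
  refine (special_bot r).of_relIndex_eq_pow (k := b) ⟨bot_le, fun g _ x => ?_⟩ ?_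
    (fun _ _ _ _ => rfl) hψ ?_
  · simp only [Subgroup.mem_bot]; exact conj_eq_one_iff
  · rw [Subgroup.relIndex_bot_left, hb]
  · simpa [ip, show ((default : (⊥ : Subgroup Γ)) : Γ) = 1 from rfl] using hψ.one_ne_zero

theorem pres_mem_span_irrNotOver {r : ℕ} [Fact r.Prime] [Group.IsSolvable Γ] {M : Subgroup Γ}
    [M.Normal] (hM : IsPGroup r M) {χ : Γ → ℂ} (hχ : Irr ⊤ χ) (h : ∃ m ∈ M, χ m ≠ χ 1) :
    pres r ⊤ χ ∈ Submodule.span ℂ (pres r ⊤ '' irrNotOver r M) := by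
  obtain ⟨ψ, hψ, hχψ, x, hx, hψx⟩ : ∃ ψ, Irr M ψ ∧ ip M χ ψ ≠ 0 ∧ ∃ x ∈ M, ψ x ≠ 1 := by
    by_contra! hc
    obtain ⟨e, he⟩ := (hχ.isChar.restrict (le_top : M ≤ ⊤)).eq_nat_mul (θ := fun _ => 1) hc
    obtain ⟨m, hm, hne⟩ := h
    exact hne ((he m hm).trans (he 1 M.one_mem).symm)
  have hN : NormIn M ⊤ := ⟨le_top, fun g _ x =>
    (Subgroup.Normal.mem_comm_iff ‹_›).trans (by simp)⟩
  refine Submodule.span_mono (Set.image_mono ?_)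
    ((special_of_isPGroup hM hψ).pres_mem_span hN inferInstance hχ hχψ)
  rintro φ ⟨⟨hφ, hφψ⟩, hgal⟩
  refine ⟨isIrreducibleCharacter_iff.mpr hφ, fun g => mem_Qfield_of_forall
    (hφ.isChar.isIntegral (Subgroup.mem_top g)) fun σ hσ => hgal σ hσ g (Subgroup.mem_top g), ?_⟩
  by_contra! hc
  obtain ⟨n, hn⟩ := hφ.isChar.one_nat
  have h1 : ip M φ ψ = n * ip M (fun _ => 1) ψ := by
    rw [← ip_smul_left]
    exact ip_congr (fun x hx => by simp [hc x hx, hn]) fun _ _ => rfl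
  have h2 := (irr_one M).eq_of_ip_ne_zero hψ (right_ne_zero_of_mul (h1 ▸ hφψ))
  exact hψx (h2 x hx).symm

/-- The inflation to `Γ` of the indicator function of a conjugacy class of `Γ ⧸ M`. -/
def inflIndicator (M : Subgroup Γ) [M.Normal] (d : ConjClasses (Γ ⧸ M)) (x : Γ) : ℂ :=
  if ConjClasses.mk (x : Γ ⧸ M) = d then 1 else 0

theorem pres_mem_span_inflIndicator {r : ℕ} {M : Subgroup Γ} [M.Normal] {χ : Γ → ℂ}
    (hχ : IsChar ⊤ χ) (h : ∀ m ∈ M, χ m = χ 1) :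
    pres r ⊤ χ ∈ Submodule.span ℂ
      ((fun d => pres r ⊤ (inflIndicator M d)) '' rClasses r (Γ ⧸ M)) := by
  have hrep : ∀ d : ConjClasses (Γ ⧸ M), ∃ y : Γ, ConjClasses.mk (y : Γ ⧸ M) = d := fun d => by
    obtain ⟨y, rfl⟩ := ConjClasses.mk_surjective d
    obtain ⟨y, rfl⟩ := QuotientGroup.mk_surjective y
    exact ⟨y, rfl⟩
  choose y hy using hrep
  have hχy : ∀ x : Γ, χ x = χ (y (ConjClasses.mk (x : Γ ⧸ M))) := fun x => by
    obtain ⟨c, hc⟩ := isConj_iff.mp (ConjClasses.mk_eq_mk_iff_isConj.mp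
      (hy (ConjClasses.mk (x : Γ ⧸ M))).symm)
    obtain ⟨c, rfl⟩ := QuotientGroup.mk_surjective c
    have h1 : ((c * x * c⁻¹ : Γ) : Γ ⧸ M) = y (ConjClasses.mk (x : Γ ⧸ M)) := hc
    have h2 := hχ.mul_eq le_top h (Subgroup.mem_top (c * x * c⁻¹)) (QuotientGroup.eq.mp h1)
    rw [mul_inv_cancel_left, hχ.conj (Subgroup.mem_top c) (Subgroup.mem_top x)] at h2
    exact h2.symm
  have hsum : pres r ⊤ χ = ∑ d, χ (y d) • pres r ⊤ (inflIndicator M d) := by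
    simp only [← map_smul, ← map_sum]
    refine pres_congr fun x _ _ _ => ?_
    simp [inflIndicator, ← hχy]
  rw [hsum]
  refine Submodule.sum_mem _ fun d _ => Submodule.smul_mem _ _ ?_
  by_cases hd : d ∈ rClasses r (Γ ⧸ M)
  · exact Submodule.subset_span ⟨d, hd, rfl⟩
  · have h0 : pres r ⊤ (inflIndicator M d) = pres r ⊤ 0 := pres_congr fun x _ k hk => by
      refine if_neg fun (hxd : ConjClasses.mk (x : Γ ⧸ M) = d) =>
        hd (hxd ▸ mk_mem_rClasses.mpr ⟨k, ?_⟩)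
      rw [← QuotientGroup.mk_pow, hk, QuotientGroup.mk_one]
    rw [h0, map_zero]
    exact Submodule.zero_mem _

theorem ncard_rClasses_le {r : ℕ} [Fact r.Prime] [Group.IsSolvable Γ] {M : Subgroup Γ}
    [M.Normal] (hM : IsPGroup r M) :
    (rClasses r Γ).ncard ≤ (rClasses r (Γ ⧸ M)).ncard + (irrNotOver r M).ncard := by
  have hfin : (irrNotOver r M).Finite :=
    (finite_isIrreducibleCharacter Γ).subset fun _ h => h.1
  set S : Set (Γ → ℂ) := (fun d => pres r ⊤ (inflIndicator M d)) '' rClasses r (Γ ⧸ M) ∪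
    pres r ⊤ '' irrNotOver r M with hS
  have hSfin : S.Finite := ((Set.toFinite _).image _).union (hfin.image _)
  let v : rClasses r Γ → Γ → ℂ := fun c x => if ConjClasses.mk x = c then 1 else 0
  have hli : LinearIndependent ℂ v := by
    refine Fintype.linearIndependent_iff.mpr fun a ha c => ?_
    obtain ⟨g, hg⟩ := ConjClasses.mk_surjective (c : ConjClasses Γ)
    have h1 := congrFun ha g
    simpa [v, hg, Subtype.coe_inj] using h1
  have hv : ∀ c, v c ∈ Submodule.span ℂ S := fun c => by
    have hcl : IsClassFun ⊤ (v c) := fun g _ x _ => by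
      simp only [v]
      rw [ConjClasses.mk_eq_mk_iff_isConj.mpr (isConj_iff.mpr ⟨g, rfl⟩ : IsConj x (g * x * g⁻¹))]
    have h1 : v c = ∑ χ ∈ irrs ⊤, ip ⊤ (v c) χ • pres r ⊤ χ := by
      have h2 : v c = pres r ⊤ (v c) := funext fun x => by
        rw [pres_apply]
        split_ifs with hx
        · rfl
        · exact if_neg fun (hxc : ConjClasses.mk x = c) =>
            hx ⟨Subgroup.mem_top x, mk_mem_rClasses.mp (hxc ▸ c.2)⟩
      conv_lhs => rw [h2]
      simp only [← map_smul, ← map_sum]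
      refine pres_congr fun x hx _ _ => ?_
      simpa using hcl.expansion x hx
    rw [h1]
    refine Submodule.sum_mem _ fun χ hχ => Submodule.smul_mem _ _ ?_
    have hχ := (mem_irrs.mp hχ).1
    by_cases h : ∀ m ∈ M, χ m = χ 1
    · exact Submodule.span_mono Set.subset_union_left (pres_mem_span_inflIndicator hχ.isChar h)
    · push Not at h
      exact Submodule.span_mono Set.subset_union_right (pres_mem_span_irrNotOver hM hχ h)
  have : Fintype S := hSfin.fintype
  calc (rClasses r Γ).ncard = Module.finrank ℂ (Submodule.span ℂ (Set.range v)) := by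
        rw [finrank_span_eq_card hli, ← Nat.card_eq_fintype_card]; rfl
    _ ≤ Module.finrank ℂ (Submodule.span ℂ S) :=
        Submodule.finrank_mono (Submodule.span_le.mpr (by rintro _ ⟨c, rfl⟩; exact hv c))
    _ ≤ S.ncard := by
        rw [Set.ncard_eq_toFinset_card']
        exact finrank_span_le_card S
    _ ≤ _ := (Set.ncard_union_le _ _).trans
        (add_le_add (Set.ncard_image_le (Set.toFinite _)) (Set.ncard_image_le hfin))

theorem finite_QppValuedIrrChars (Γ : Type) [Group Γ] [Fintype Γ] : (QppValuedIrrChars Γ).Finite :=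
  (finite_isIrreducibleCharacter Γ).subset fun _ h => h.1

theorem ncard_QppValuedIrrChars_add_le {r : ℕ} (hr : r.Prime) (M : Subgroup Γ) [M.Normal] :
    (QppValuedIrrChars (Γ ⧸ M)).ncard + (irrNotOver r M).ncard ≤
      (QppValuedIrrChars Γ).ncard := by
  have hfin : (irrNotOver r M).Finite :=
    (finite_isIrreducibleCharacter Γ).subset fun _ h => h.1
  let infl : (Γ ⧸ M → ℂ) → Γ → ℂ := fun f x => f x
  have hinj : Function.Injective infl := QuotientGroup.mk_surjective.injective_comp_right
  rw [← Set.ncard_image_of_injective _ hinj,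
    ← Set.ncard_union_eq ?_ ((finite_QppValuedIrrChars _).image _) hfin]
  · refine Set.ncard_le_ncard (Set.union_subset ?_ fun χ h => ⟨h.1, r, hr, h.2.1⟩)
      (finite_QppValuedIrrChars Γ)
    rintro _ ⟨f, ⟨hf, p, hp, h⟩, rfl⟩
    exact ⟨hf.comp_mk, p, hp, fun g => h g⟩
  · rw [Set.disjoint_left]
    rintro _ ⟨f, -, rfl⟩ ⟨-, -, m, hm, hne⟩
    exact hne (congrArg f ((QuotientGroup.eq_one_iff m).mpr hm))

theorem ncard_primePowerClasses_le (Γ : Type) [Group Γ] [Fintype Γ] [Group.IsSolvable Γ] :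
    (PrimePowerClasses Γ).ncard ≤ (QppValuedIrrChars Γ).ncard := by
  induction hn : Nat.card Γ using Nat.strong_induction_on generalizing Γ with
  | _ n ih =>
  subst hn
  rcases subsingleton_or_nontrivial Γ with hΓ | hΓ
  · have h1 : (QppValuedIrrChars Γ).Nonempty := ⟨fun _ => 1,
      isIrreducibleCharacter_iff.mpr (irr_one ⊤), 2, Nat.prime_two, fun _ => one_mem _⟩
    refine le_trans (Set.ncard_le_one_iff_subsingleton.mpr fun c _ d _ => ?_)
      ((Set.ncard_pos (finite_QppValuedIrrChars Γ)).mpr h1)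
    obtain ⟨g, rfl⟩ := ConjClasses.mk_surjective c
    obtain ⟨h, rfl⟩ := ConjClasses.mk_surjective d
    rw [Subsingleton.elim g h]
  · obtain ⟨r, M, hr, hMn, hM1, hM, -⟩ := exists_normal_isPGroup Γ
    have : Fact r.Prime := ⟨hr⟩
    have hcard : Nat.card (Γ ⧸ M) < Nat.card Γ := by
      rw [Subgroup.card_eq_card_quotient_mul_card_subgroup M]
      exact lt_mul_of_one_lt_right Nat.card_pos ((Subgroup.one_lt_card_iff_ne_bot M).mpr hM1)
    have h1 := ih _ hcard (Γ ⧸ M) rfl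
    have h2 := ncard_primePowerClasses_diff_le hr hM
    have h3 := ncard_rClasses_le hM
    have h4 := ncard_QppValuedIrrChars_add_le hr M
    have h5 := Set.ncard_sdiff_add_ncard_of_subset (rClasses_subset (Γ := Γ) hr)
    have h6 := Set.ncard_sdiff_add_ncard_of_subset (rClasses_subset (Γ := Γ ⧸ M) hr)
    omega

end

/-- If `G` is a finite solvable group, then the number of conjugacy classes of elements
of prime power order is at most the number of `Q_pp`-valued irreducible characters. -/
theorem primePowerClasses_le_QppValuedIrrChars (G : Type) [Group G] [Fintype G]
    (hG : IsSolvable G) :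
    (PrimePowerClasses G).ncard ≤ (QppValuedIrrChars G).ncard := by
  have : Group.IsSolvable G := hG
  exact ncard_primePowerClasses_le G
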